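/- arXiv:2303.04728 — 3 statements merged into one kernel-verified Lean document; each statement's English description precedes it below -/
import Mathlib

section
/- Let 1 ≤ q ≤ ∞ and n ∈ ℕ. Let E_1,…,E_{n+1} be independent standard exponential random variables, let ε = (ε_1,…,ε_n) be uniformly distributed on {-1,1}^n, and let π be uniformly distributed on the symmetric group S_n, all independent of each other. Then the random vector whose i-th coordinate is ε_i · (Σ_{j=π(i)}^{n} κ_q(j)^{-1} E_j) / (Σ_{j=1}^{n+1} E_j) is uniformly distributed on the Lorentz unit ball B_{q,1}^n, i.e., its law equals the normalized Lebesgue measure restricted to B_{q,1}^n. -/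
open MeasureTheory Finset
open scoped ENNReal NNReal

noncomputable section

/-- `sortedAbs x i` is the `i`-th largest value among `|x 0|, …, |x (n-1)|`
(`i = 0` gives the largest), i.e. the non-increasing rearrangement of `|x|`. -/
def sortedAbs {n : ℕ} (x : Fin n → ℝ) (i : Fin n) : ℝ :=
  |x (Tuple.sort (fun j => |x j|) i.rev)|

/-- The weight `i ^ (1/q - 1)` appearing in the Lorentz `(q,1)`-norm, for `q ∈ [1,∞]`,
with the convention `1/∞ = 0` (so the weight is `i⁻¹` for `q = ∞`). -/
def lorentzWeight (q : ℝ≥0∞) (i : ℕ) : ℝ := (i : ℝ) ^ (1 / q.toReal - 1)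

/-- The Lorentz norm `‖x‖_{q,1} = ∑_{i=1}^n i^{1/q-1} x_i^*`. -/
def lorentzNorm (q : ℝ≥0∞) {n : ℕ} (x : Fin n → ℝ) : ℝ :=
  ∑ i : Fin n, lorentzWeight q ((i : ℕ) + 1) * sortedAbs x i

/-- The unit ball of the Lorentz space `ℓ_{q,1}^n`. -/
def lorentzBall (q : ℝ≥0∞) (n : ℕ) : Set (Fin n → ℝ) :=
  {x | lorentzNorm q x ≤ 1}

/-- `kappa q j = κ_q(j) = ∑_{i=1}^j i^{1/q-1}`. -/
def kappa (q : ℝ≥0∞) (j : ℕ) : ℝ := ∑ i ∈ Finset.range j, lorentzWeight q (i + 1)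

/-- The (discrete) measurable structure on the symmetric group `S_n`. -/
instance {n : ℕ} : MeasurableSpace (Equiv.Perm (Fin n)) := ⊤

lemma lintegral_fin_prod_eq_prod {n : ℕ} (μ : Fin n → Measure ℝ) [∀ i, SigmaFinite (μ i)]
    {f : Fin n → ℝ → ℝ≥0∞} (hf : ∀ i, Measurable (f i)) :
    ∫⁻ x, ∏ i, f i (x i) ∂Measure.pi μ = ∏ i, ∫⁻ t, f i t ∂μ i := by
  induction n with
  | zero => simp
  | succ n ih =>
    rw [← ((measurePreserving_piFinSuccAbove μ 0).symm).lintegral_comp_emb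
      (MeasurableEquiv.measurableEmbedding _)]
    have hm : Measurable fun x : Fin n → ℝ => ∏ i, f (Fin.succ i) (x i) :=
      Finset.measurable_fun_prod _ fun i _ => (hf _).comp (measurable_pi_apply i)
    simp only [MeasurableEquiv.piFinSuccAbove_symm_apply, Fin.insertNthEquiv_zero,
      Fin.consEquiv_apply, Fin.prod_univ_succ, Fin.cons_zero, Fin.cons_succ]
    rw [lintegral_prod_mul (hf 0).aemeasurable hm.aemeasurable]
    congr 1
    exact ih (fun i => μ (Fin.succ i)) fun i => hf _

lemma pi_withDensity_fin {n : ℕ} {g : ℝ → ℝ≥0∞} (hg : Measurable g)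
    [SigmaFinite (volume.withDensity g)] :
    (Measure.pi fun _ : Fin n => (volume : Measure ℝ).withDensity g)
      = (volume : Measure (Fin n → ℝ)).withDensity fun x => ∏ i, g (x i) := by
  refine (Measure.pi_eq fun s hs => ?_)
  rw [withDensity_apply _ (MeasurableSet.univ_pi hs),
    ← lintegral_indicator (MeasurableSet.univ_pi hs)]
  simp_rw [withDensity_apply _ (hs _), ← lintegral_indicator (hs _)]
  rw [← lintegral_fin_prod_eq_prod _ fun i => hg.indicator (hs i)]
  refine lintegral_congr fun x => ?_
  by_cases hx : x ∈ Set.univ.pi s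
  · rw [Set.indicator_of_mem hx]
    exact Finset.prod_congr rfl fun i _ => (Set.indicator_of_mem (hx i trivial) _).symm
  · rw [Set.indicator_of_notMem hx]
    simp only [Set.mem_pi, Set.mem_univ, true_imp_iff, not_forall] at hx
    obtain ⟨i, hi⟩ := hx
    exact (Finset.prod_eq_zero (Finset.mem_univ i) (Set.indicator_of_notMem hi _)).symm

lemma expMeasure_one_eq_withDensity_Ici :
    ProbabilityTheory.expMeasure 1
      = volume.withDensity ((Set.Ici 0).indicator fun t => ENNReal.ofReal (Real.exp (-t))) := by
  change volume.withDensity (ProbabilityTheory.exponentialPDF 1) = _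
  congr 1
  ext t
  rw [ProbabilityTheory.exponentialPDF_eq]
  by_cases ht : 0 ≤ t <;> simp [ht]

lemma expMeasure_one_eq_withDensity_Ioi :
    ProbabilityTheory.expMeasure 1
      = volume.withDensity ((Set.Ioi 0).indicator fun t => ENNReal.ofReal (Real.exp (-t))) := by
  rw [expMeasure_one_eq_withDensity_Ici]
  exact withDensity_congr_ae (indicator_ae_eq_of_ae_eq_set Ioi_ae_eq_Ici.symm)

/-- The half-open solid simplex `{u | u > 0, ∑ u ≤ 1}`. -/
def solidSimplex (n : ℕ) : Set (Fin n → ℝ) := {u | (∀ i, 0 < u i) ∧ ∑ i, u i ≤ 1}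

lemma measurableSet_solidSimplex (n : ℕ) : MeasurableSet (solidSimplex n) := by
  have h : solidSimplex n = (⋂ i, {u : Fin n → ℝ | 0 < u i}) ∩ {u | ∑ i, u i ≤ 1} := by
    ext u
    simp [solidSimplex]
  rw [h]
  exact (MeasurableSet.iInter fun i => measurableSet_lt measurable_const (measurable_pi_apply i)).inter
    (measurableSet_le (f := fun u : Fin n → ℝ => ∑ i, u i) (by fun_prop) measurable_const)

lemma volume_dilated_simplex {n : ℕ} {A : Set (Fin n → ℝ)} {s : ℝ} (hs : s ≠ 0) :
    volume {x : Fin n → ℝ | (∀ i, 0 < x i) ∧ ∑ i, x i ≤ s ∧ s⁻¹ • x ∈ A}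
      = (Set.Ioi 0).indicator (fun s => ENNReal.ofReal (s ^ n)) s * volume (A ∩ solidSimplex n) := by
  rcases hs.lt_or_gt with h | h
  · rw [Set.indicator_of_notMem (by simpa using h.le), zero_mul]
    convert measure_empty (μ := volume)
    refine Set.eq_empty_of_forall_notMem fun x hx => ?_
    have := Finset.sum_nonneg (s := univ) fun i _ => (hx.1 i).le
    linarith [hx.2.1]
  · rw [Set.indicator_of_mem (by simpa using h)]
    have : {x : Fin n → ℝ | (∀ i, 0 < x i) ∧ ∑ i, x i ≤ s ∧ s⁻¹ • x ∈ A}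
        = (fun x => s⁻¹ • x) ⁻¹' (A ∩ solidSimplex n) := by
      ext x
      simp only [solidSimplex, Set.mem_ofPred_eq, Set.mem_preimage, Set.mem_inter_iff,
        Pi.smul_apply, smul_eq_mul, ← Finset.mul_sum]
      rw [inv_mul_le_one₀ h]
      simp only [inv_pos.2 h, mul_pos_iff_of_pos_left]
      tauto
    rw [this, Measure.addHaar_preimage_smul _ (inv_ne_zero hs)]
    simp [abs_of_pos h]

lemma map_exp_normalized {n : ℕ} : ∃ c : ℝ≥0∞,
    Measure.map (fun (e : Fin (n + 1) → ℝ) (i : Fin n) => e i.castSucc / ∑ j, e j)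
      (Measure.pi fun _ => ProbabilityTheory.expMeasure 1)
      = c • volume.restrict (solidSimplex n) := by
  have := ProbabilityTheory.isProbabilityMeasure_expMeasure one_pos
  set g := (Set.Ioi (0:ℝ)).indicator fun t => ENNReal.ofReal (Real.exp (-t))
  set g' := (Set.Ici (0:ℝ)).indicator fun t => ENNReal.ofReal (Real.exp (-t))
  have hgm : Measurable g := by
    refine Measurable.indicator ?_ measurableSet_Ioi; fun_prop
  have hgm' : Measurable g' := by
    refine Measurable.indicator ?_ measurableSet_Ici; fun_prop
  have hE : ProbabilityTheory.expMeasure 1 = volume.withDensity g :=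
    expMeasure_one_eq_withDensity_Ioi
  have hE' : ProbabilityTheory.expMeasure 1 = volume.withDensity g' :=
    expMeasure_one_eq_withDensity_Ici
  have hpi : (Measure.pi fun _ : Fin n => ProbabilityTheory.expMeasure 1)
      = (volume : Measure (Fin n → ℝ)).withDensity fun x => ∏ i, g (x i) := by
    have : SigmaFinite (volume.withDensity g) := by rw [← hE]; infer_instance
    rw [hE, pi_withDensity_fin hgm]
  have hGm : Measurable fun x : Fin n → ℝ => ∏ i, g (x i) :=
    Finset.measurable_fun_prod _ fun i _ => hgm.comp (measurable_pi_apply i)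
  refine ⟨∫⁻ s, ENNReal.ofReal (Real.exp (-s)) *
    (Set.Ioi 0).indicator (fun s => ENNReal.ofReal (s ^ n)) s, ?_⟩
  have hFm : Measurable fun (e : Fin (n + 1) → ℝ) (i : Fin n) => e i.castSucc / ∑ j, e j :=
    measurable_pi_lambda _ fun i => by fun_prop
  ext A hA
  rw [Measure.map_apply hFm hA, Measure.smul_apply, Measure.restrict_apply hA, smul_eq_mul,
    ← lintegral_indicator_one (hFm hA),
    ← ((measurePreserving_piFinSuccAbove
      (fun _ : Fin (n + 1) => ProbabilityTheory.expMeasure 1) (Fin.last n)).symm).lintegral_comp_emb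
      (MeasurableEquiv.measurableEmbedding _)]
  have hval : ∀ p : ℝ × (Fin n → ℝ), (((fun (e : Fin (n + 1) → ℝ) (i : Fin n) =>
        e i.castSucc / ∑ j, e j) ⁻¹' A).indicator (1 : (Fin (n + 1) → ℝ) → ℝ≥0∞)
        ((MeasurableEquiv.piFinSuccAbove (fun _ => ℝ) (Fin.last n)).symm p))
      = A.indicator 1 ((p.1 + ∑ j, p.2 j)⁻¹ • p.2) := by
    rintro ⟨t, x⟩
    have hx : (fun i : Fin n => (MeasurableEquiv.piFinSuccAbove (fun _ => ℝ) (Fin.last n)).symm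
        (t, x) i.castSucc / ∑ j, (MeasurableEquiv.piFinSuccAbove (fun _ => ℝ) (Fin.last n)).symm
        (t, x) j) = (t + ∑ j, x j)⁻¹ • x := by
      ext i
      simp [Fin.insertNthEquiv, Fin.sum_univ_castSucc, div_eq_inv_mul, add_comm]
    rw [← hx]
    rfl
  simp_rw [hval]
  have hind : Measurable (A.indicator (1 : (Fin n → ℝ) → ℝ≥0∞)) := measurable_one.indicator hA
  have hm1 : Measurable fun p : ℝ × (Fin n → ℝ) =>
      A.indicator (1 : (Fin n → ℝ) → ℝ≥0∞) ((p.1 + ∑ j, p.2 j)⁻¹ • p.2) :=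
    hind.comp (by fun_prop)
  rw [lintegral_prod_symm' _ hm1, hpi, hE',
    lintegral_withDensity_eq_lintegral_mul _ hGm hm1.lintegral_prod_left']
  have key : ∀ (s : ℝ) (x : Fin n → ℝ), (∏ i, g (x i)) * (g' (s - ∑ j, x j) *
      A.indicator 1 (s⁻¹ • x)) = ENNReal.ofReal (Real.exp (-s)) *
        {x : Fin n → ℝ | (∀ i, 0 < x i) ∧ ∑ i, x i ≤ s ∧ s⁻¹ • x ∈ A}.indicator 1 x := by
    intro s x
    by_cases h1 : ∀ i, 0 < x i
    · have e1 : ∏ i, g (x i) = ENNReal.ofReal (Real.exp (-∑ i, x i)) := by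
        rw [← Finset.sum_neg_distrib, Real.exp_sum,
          ENNReal.ofReal_prod_of_nonneg fun _ _ => (Real.exp_pos _).le]
        exact Finset.prod_congr rfl fun i _ => Set.indicator_of_mem (h1 i) _
      by_cases h2 : ∑ i, x i ≤ s
      · have e2 : g' (s - ∑ j, x j) = ENNReal.ofReal (Real.exp (-(s - ∑ j, x j))) :=
          Set.indicator_of_mem (sub_nonneg.2 h2) _
        rw [← mul_assoc, e1, e2, ← ENNReal.ofReal_mul (Real.exp_pos _).le, ← Real.exp_add]
        congr 1
        · congr 2; ring
        · refine Set.indicator_eq_indicator ?_ rfl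
          simp [h1, h2]
      · have e2 : g' (s - ∑ j, x j) = 0 :=
          Set.indicator_of_notMem (by simpa using h2) _
        simp [e2, h2]
    · have h1' := h1
      push Not at h1'
      obtain ⟨i, hi⟩ := h1'
      have e1 : ∏ i, g (x i) = 0 := Finset.prod_eq_zero (Finset.mem_univ i)
        (Set.indicator_of_notMem (by simpa using hi) _)
      simp [e1, h1]
  have inner : ∀ x : Fin n → ℝ, ((fun x : Fin n → ℝ => ∏ i, g (x i)) * fun y : Fin n → ℝ =>
      ∫⁻ t, A.indicator (1 : (Fin n → ℝ) → ℝ≥0∞) ((t + ∑ j, y j)⁻¹ • y)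
        ∂(volume.withDensity g')) x
      = ∫⁻ s, ENNReal.ofReal (Real.exp (-s)) *
        {x : Fin n → ℝ | (∀ i, 0 < x i) ∧ ∑ i, x i ≤ s ∧ s⁻¹ • x ∈ A}.indicator 1 x := by
    intro x
    have hm2 : Measurable fun t : ℝ =>
        A.indicator (1 : (Fin n → ℝ) → ℝ≥0∞) ((t + ∑ j, x j)⁻¹ • x) :=
      hind.comp (by fun_prop)
    simp_rw [← key _ x]
    rw [Pi.mul_apply, lintegral_withDensity_eq_lintegral_mul _ hgm' hm2,
      lintegral_const_mul _ (by
        refine Measurable.mul (hgm'.comp (by fun_prop)) (hind.comp (by fun_prop)))]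
    congr 1
    rw [← lintegral_add_right_eq_self (fun s => g' (s - ∑ j, x j) * _) (∑ j, x j)]
    simp
  simp_rw [inner]
  have hS : MeasurableSet {p : (Fin n → ℝ) × ℝ |
      (∀ i, 0 < p.1 i) ∧ ∑ i, p.1 i ≤ p.2 ∧ p.2⁻¹ • p.1 ∈ A} := by
    have h : {p : (Fin n → ℝ) × ℝ | (∀ i, 0 < p.1 i) ∧ ∑ i, p.1 i ≤ p.2 ∧ p.2⁻¹ • p.1 ∈ A}
        = (⋂ i, {p | 0 < p.1 i}) ∩ ({p | ∑ i, p.1 i ≤ p.2} ∩ (fun p => p.2⁻¹ • p.1) ⁻¹' A) := by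
      ext p
      simp
    rw [h]
    refine (MeasurableSet.iInter fun i => ?_).inter (MeasurableSet.inter ?_ ?_)
    · exact measurableSet_lt measurable_const ((measurable_pi_apply i).comp measurable_fst)
    · exact measurableSet_le (f := fun p : (Fin n → ℝ) × ℝ => ∑ i, p.1 i) (by fun_prop)
        measurable_snd
    · exact (show Measurable fun p : (Fin n → ℝ) × ℝ => p.2⁻¹ • p.1 by fun_prop) hA
  rw [lintegral_lintegral_swap]
  · rw [← lintegral_mul_const]
    · refine lintegral_congr_ae ?_
      filter_upwards [Measure.ae_ne volume (0 : ℝ)] with s hs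
      rw [lintegral_const_mul', lintegral_indicator_one, volume_dilated_simplex hs, mul_assoc]
      · exact hS.preimage (measurable_prodMk_right (y := s))
      · simp
    · refine Measurable.mul (by fun_prop) (Measurable.indicator ?_ measurableSet_Ioi)
      fun_prop
  · refine Measurable.aemeasurable (Measurable.mul (by fun_prop) ?_)
    exact measurable_one.indicator hS

lemma lorentzWeight_pos (q : ℝ≥0∞) {i : ℕ} (hi : 0 < i) : 0 < lorentzWeight q i :=
  Real.rpow_pos_of_pos (by exact_mod_cast hi) _

lemma kappa_pos (q : ℝ≥0∞) {j : ℕ} (hj : 0 < j) : 0 < kappa q j :=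
  Finset.sum_pos (fun _ _ => lorentzWeight_pos q (Nat.succ_pos _)) ⟨0, by simpa using hj⟩

/-- The weighted tail sums `∑_{j ≥ m} κ_q(j)⁻¹ u_j` (with zero-based indices). -/
def weightedTail (q : ℝ≥0∞) {n : ℕ} (u : Fin n → ℝ) (m : ℕ) : ℝ :=
  ∑ j : Fin n, if m ≤ (j : ℕ) then (kappa q ((j : ℕ) + 1))⁻¹ * u j else 0

lemma weightedTail_sub_succ (q : ℝ≥0∞) {n : ℕ} (u : Fin n → ℝ) (k : Fin n) :
    weightedTail q u k - weightedTail q u (k + 1) = (kappa q ((k : ℕ) + 1))⁻¹ * u k := by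
  rw [weightedTail, weightedTail, ← Finset.sum_sub_distrib, Finset.sum_eq_single k]
  · simp
  · intro j _ hj
    have : (j : ℕ) ≠ k := fun h => hj (Fin.ext h)
    by_cases h : (k : ℕ) ≤ j
    · rw [if_pos h, if_pos (by omega), sub_self]
    · rw [if_neg h, if_neg (by omega), sub_self]
  · simp

lemma weightedTail_eq_zero (q : ℝ≥0∞) {n : ℕ} (u : Fin n → ℝ) {m : ℕ} (hm : n ≤ m) :
    weightedTail q u m = 0 :=
  Finset.sum_eq_zero fun j _ => if_neg (by omega)

/-- The linear map sending `u` to the vector of its weighted tail sums. -/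
def tailMap (q : ℝ≥0∞) (n : ℕ) : (Fin n → ℝ) →ₗ[ℝ] (Fin n → ℝ) where
  toFun u k := weightedTail q u k
  map_add' u v := by
    ext k
    simp only [weightedTail, Pi.add_apply, ← Finset.sum_add_distrib]
    exact Finset.sum_congr rfl fun j _ => by split_ifs <;> ring
  map_smul' c u := by
    ext k
    simp only [weightedTail, Pi.smul_apply, smul_eq_mul, RingHom.id_apply, Finset.mul_sum]
    exact Finset.sum_congr rfl fun j _ => by split_ifs <;> ring

lemma tailMap_apply (q : ℝ≥0∞) {n : ℕ} (u : Fin n → ℝ) (k : Fin n) :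
    tailMap q n u k = weightedTail q u k := rfl

lemma det_tailMap_ne_zero (q : ℝ≥0∞) (n : ℕ) : LinearMap.det (tailMap q n) ≠ 0 := by
  have hinj : Function.Injective (tailMap q n) := by
    rw [← LinearMap.ker_eq_bot, LinearMap.ker_eq_bot']
    intro u hu
    have h0 : ∀ m : ℕ, weightedTail q u m = 0 := fun m => by
      rcases lt_or_ge m n with h | h
      · exact congrFun hu ⟨m, h⟩
      · exact weightedTail_eq_zero q u h
    ext k
    have := weightedTail_sub_succ q u k
    rw [h0, h0, sub_zero, eq_comm, mul_eq_zero] at this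
    exact this.resolve_left (inv_ne_zero (kappa_pos q (Nat.succ_pos _)).ne')
  exact (LinearEquiv.isUnit_det' (LinearEquiv.ofInjectiveEndo _ hinj)).ne_zero

/-- The part of the Lorentz ball made of strictly decreasing positive vectors. -/
def lorentzChamber (q : ℝ≥0∞) (n : ℕ) : Set (Fin n → ℝ) :=
  {y | ((∀ i, 0 < y i) ∧ StrictAnti y) ∧ ∑ i : Fin n, lorentzWeight q ((i : ℕ) + 1) * y i ≤ 1}

lemma measurableSet_lorentzChamber (q : ℝ≥0∞) (n : ℕ) :
    MeasurableSet (lorentzChamber q n) := by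
  have h : lorentzChamber q n = ((⋂ i, {y : Fin n → ℝ | 0 < y i}) ∩
      ⋂ i, ⋂ j, ⋂ _ : i < j, {y : Fin n → ℝ | y j < y i}) ∩
      {y | ∑ i : Fin n, lorentzWeight q ((i : ℕ) + 1) * y i ≤ 1} := by
    ext y
    simp [lorentzChamber, StrictAnti]
  rw [h]
  refine MeasurableSet.inter (MeasurableSet.inter ?_ ?_) ?_
  · exact MeasurableSet.iInter fun i => measurableSet_lt measurable_const (measurable_pi_apply i)
  · exact MeasurableSet.iInter fun i => MeasurableSet.iInter fun j => MeasurableSet.iInter fun _ =>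
      measurableSet_lt (measurable_pi_apply j) (measurable_pi_apply i)
  · exact measurableSet_le
      (f := fun y : Fin n → ℝ => ∑ i : Fin n, lorentzWeight q ((i : ℕ) + 1) * y i)
      (by fun_prop) measurable_const

lemma sum_lorentzWeight_mul_tailMap (q : ℝ≥0∞) {n : ℕ} (u : Fin n → ℝ) :
    ∑ i : Fin n, lorentzWeight q ((i : ℕ) + 1) * tailMap q n u i = ∑ j, u j := by
  simp only [tailMap_apply, weightedTail, Finset.mul_sum]
  rw [Finset.sum_comm]
  refine Finset.sum_congr rfl fun j _ => ?_
  have hk : ∑ i : Fin n, (if (i : ℕ) ≤ j then lorentzWeight q ((i : ℕ) + 1) else 0)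
      = kappa q ((j : ℕ) + 1) := by
    rw [Fin.sum_univ_eq_sum_range (fun i => if i ≤ (j : ℕ) then lorentzWeight q (i + 1) else 0) n,
      ← Finset.sum_filter, kappa]
    congr 1
    ext i
    simp only [Finset.mem_filter, Finset.mem_range]
    omega
  calc _ = (∑ i : Fin n, (if (i : ℕ) ≤ j then lorentzWeight q ((i : ℕ) + 1) else 0)) *
        ((kappa q ((j : ℕ) + 1))⁻¹ * u j) := by
        rw [Finset.sum_mul]
        exact Finset.sum_congr rfl fun i _ => by split_ifs <;> ring
    _ = u j := by
        rw [hk, mul_inv_cancel_left₀ (kappa_pos q (Nat.succ_pos _)).ne']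

lemma tailMap_preimage_lorentzChamber (q : ℝ≥0∞) (n : ℕ) :
    tailMap q n ⁻¹' lorentzChamber q n = solidSimplex n := by
  ext u
  have hκ : ∀ k : Fin n, 0 < (kappa q ((k : ℕ) + 1))⁻¹ := fun k =>
    inv_pos.2 (kappa_pos q (Nat.succ_pos _))
  simp only [Set.mem_preimage, lorentzChamber, solidSimplex, Set.mem_ofPred_eq,
    sum_lorentzWeight_mul_tailMap]
  refine and_congr_left fun _ => ⟨fun ⟨hpos, hanti⟩ k => ?_, fun hu => ?_⟩
  · have h := weightedTail_sub_succ q u k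
    have h' : weightedTail q u (k + 1) < weightedTail q u k := by
      rcases lt_or_ge ((k : ℕ) + 1) n with hk | hk
      · exact hanti (a := k) (b := ⟨k + 1, hk⟩) (Fin.lt_def.2 (Nat.lt_succ_self _))
      · rw [weightedTail_eq_zero q u hk]
        exact hpos k
    rw [← sub_pos, h] at h'
    exact (mul_pos_iff_of_pos_left (hκ k)).1 h'
  · have hlt : ∀ k : Fin n, weightedTail q u (k + 1) < weightedTail q u k := fun k => by
      rw [← sub_pos, weightedTail_sub_succ]
      exact mul_pos (hκ k) (hu k)
    have hanti : Antitone (weightedTail q u) := antitone_nat_of_succ_le fun m => by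
      rcases lt_or_ge m n with hm | hm
      · exact (hlt ⟨m, hm⟩).le
      · rw [weightedTail_eq_zero q u hm, weightedTail_eq_zero q u (by omega)]
    refine ⟨fun k => ?_, fun i j hij => ?_⟩
    · calc 0 = weightedTail q u n := (weightedTail_eq_zero q u le_rfl).symm
        _ ≤ weightedTail q u (k + 1) := hanti k.2
        _ < _ := hlt k
    · exact (hanti (Nat.succ_le_of_lt (Fin.lt_def.1 hij))).trans_lt (hlt i)

/-- The signed permutation of coordinates `y ↦ (ε_i y_{σ(i)})_i`. -/
def signedPerm {n : ℕ} (ε : Fin n → ℝ) (σ : Equiv.Perm (Fin n)) (y : Fin n → ℝ) : Fin n → ℝ :=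
  fun i => ε i * y (σ i)

lemma measurePreserving_signedPerm {n : ℕ} {ε : Fin n → ℝ} (hε : ∀ i, ε i = 1 ∨ ε i = -1)
    (σ : Equiv.Perm (Fin n)) : MeasurePreserving (signedPerm ε σ) volume volume := by
  have h1 : MeasurePreserving (fun y : Fin n → ℝ => fun i => y (σ i)) volume volume := by
    have := volume_measurePreserving_piCongrLeft (fun _ : Fin n => ℝ) σ.symm
    convert this using 1
    ext y i
    simp [MeasurableEquiv.piCongrLeft, Equiv.piCongrLeft, Equiv.piCongrLeft']
  have h2 : MeasurePreserving (fun y : Fin n → ℝ => fun i => ε i * y i) volume volume := by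
    refine volume_preserving_pi (f := fun i t => ε i * t) fun i => ?_
    rcases hε i with h | h
    · simpa [h, Function.id_def] using MeasurePreserving.id (volume : Measure ℝ)
    · simpa [h] using Measure.measurePreserving_neg (volume : Measure ℝ)
  exact h2.comp h1

lemma strictAnti_comp_perm_unique {n : ℕ} {f : Fin n → ℝ} {σ τ : Equiv.Perm (Fin n)}
    (hσ : StrictAnti (f ∘ σ)) (hτ : StrictAnti (f ∘ τ)) : σ = τ := by
  have hf : Function.Injective f := by
    intro a b hab
    have := hσ.injective (a₁ := σ.symm a) (a₂ := σ.symm b) (by simpa using hab)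
    simpa using this
  have h : (f ∘ σ) ∘ Fin.rev = (f ∘ τ) ∘ Fin.rev := by
    refine (StrictMono.range_inj (hσ.comp Fin.rev_strictAnti) (hτ.comp Fin.rev_strictAnti)).1 ?_
    rw [Fin.rev_surjective.range_comp, Fin.rev_surjective.range_comp, σ.surjective.range_comp,
      τ.surjective.range_comp]
  ext i
  have := congrFun h i.rev
  simp only [Function.comp_apply, Fin.rev_rev] at this
  rw [hf this]

lemma sortedAbs_eq_of_strictAnti {n : ℕ} {x : Fin n → ℝ} {σ : Equiv.Perm (Fin n)}
    (h : StrictAnti ((fun i => |x i|) ∘ σ)) (i : Fin n) : sortedAbs x i = |x (σ i)| := by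
  have hm : Monotone ((fun i => |x i|) ∘ (Fin.revPerm.trans σ)) :=
    (h.comp Fin.rev_strictAnti).monotone
  have := congrFun (Tuple.comp_sort_eq_comp_iff_monotone.2 hm) i.rev
  simpa [sortedAbs] using this.symm

/-- The triples `(x, ε, σ)` with `ε` a sign vector such that undoing the signed permutation
`(ε, σ)` moves `x` to the fundamental chamber of the Lorentz ball. -/
def chamberSet (q : ℝ≥0∞) (n : ℕ) : Set ((Fin n → ℝ) × (Fin n → ℝ) × Equiv.Perm (Fin n)) :=
  {p | (∀ i, p.2.1 i = 1 ∨ p.2.1 i = -1) ∧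
    (fun k => p.2.1 (p.2.2.symm k) * p.1 (p.2.2.symm k)) ∈ lorentzChamber q n}

lemma measurable_apply_perm {n : ℕ} {α : Type*} [MeasurableSpace α] {f : α → Fin n → ℝ}
    {g : α → Equiv.Perm (Fin n)} (hf : Measurable f) (hg : Measurable g) (k : Fin n) :
    Measurable fun a => f a ((g a).symm k) := by
  have h : (fun a => f a ((g a).symm k)) = fun a => ∑ i, if (g a).symm k = i then f a i else 0 := by
    ext a
    simp
  rw [h]
  refine Finset.measurable_fun_sum _ fun i _ => Measurable.ite ?_ (by fun_prop) measurable_const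
  exact hg (t := {τ | τ.symm k = i}) trivial

lemma measurableSet_chamberSet (q : ℝ≥0∞) (n : ℕ) : MeasurableSet (chamberSet q n) := by
  refine MeasurableSet.inter ?_ ?_
  · have h : {p : (Fin n → ℝ) × (Fin n → ℝ) × Equiv.Perm (Fin n) |
        ∀ i, p.2.1 i = 1 ∨ p.2.1 i = -1} = ⋂ i, {p | p.2.1 i ∈ ({1, -1} : Set ℝ)} := by
      ext p
      simp
    change MeasurableSet {p : (Fin n → ℝ) × (Fin n → ℝ) × Equiv.Perm (Fin n) |
      ∀ i, p.2.1 i = 1 ∨ p.2.1 i = -1}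
    rw [h]
    refine MeasurableSet.iInter fun i => ?_
    exact ((measurable_pi_apply i).comp (measurable_fst.comp measurable_snd))
      (Set.toFinite _).measurableSet
  · have hm : Measurable fun (p : (Fin n → ℝ) × (Fin n → ℝ) × Equiv.Perm (Fin n)) (k : Fin n) =>
        p.2.1 (p.2.2.symm k) * p.1 (p.2.2.symm k) := by
      refine measurable_pi_lambda _ fun k => Measurable.mul ?_ ?_
      · exact measurable_apply_perm (by fun_prop) (by fun_prop) k
      · exact measurable_apply_perm (by fun_prop) (by fun_prop) k
    exact hm (measurableSet_lorentzChamber q n)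

lemma abs_of_mem_chamberSet {q : ℝ≥0∞} {n : ℕ} {x ε : Fin n → ℝ} {σ : Equiv.Perm (Fin n)}
    (h : (x, ε, σ) ∈ chamberSet q n) (i : Fin n) : ε i * x i = |x i| ∧ 0 < |x i| := by
  have hpos : 0 < ε i * x i := by simpa using h.2.1.1 (σ i)
  have hsign : ε i = 1 ∨ ε i = -1 := h.1 i
  have : ε i * x i = |x i| := by
    rw [← abs_of_pos hpos, abs_mul]
    rcases hsign with h1 | h1 <;> simp [h1]
  exact ⟨this, this ▸ hpos⟩

lemma mem_chamberSet_strictAnti {q : ℝ≥0∞} {n : ℕ} {x ε : Fin n → ℝ} {σ : Equiv.Perm (Fin n)}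
    (h : (x, ε, σ) ∈ chamberSet q n) : StrictAnti ((fun i => |x i|) ∘ σ.symm) := by
  have : StrictAnti fun k => ε (σ.symm k) * x (σ.symm k) := h.2.1.2
  simp only [(abs_of_mem_chamberSet h _).1] at this
  exact this

lemma mem_lorentzBall_of_mem_chamberSet {q : ℝ≥0∞} {n : ℕ} {x ε : Fin n → ℝ}
    {σ : Equiv.Perm (Fin n)} (h : (x, ε, σ) ∈ chamberSet q n) : x ∈ lorentzBall q n := by
  have : ∑ i : Fin n, lorentzWeight q ((i : ℕ) + 1) * (ε (σ.symm i) * x (σ.symm i)) ≤ 1 := h.2.2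
  simp only [(abs_of_mem_chamberSet h _).1] at this
  simp only [lorentzBall, lorentzNorm, Set.mem_ofPred_eq,
    sortedAbs_eq_of_strictAnti (mem_chamberSet_strictAnti h), this]

lemma chamberSet_unique {q : ℝ≥0∞} {n : ℕ} {x ε ε' : Fin n → ℝ} {σ σ' : Equiv.Perm (Fin n)}
    (h : (x, ε, σ) ∈ chamberSet q n) (h' : (x, ε', σ') ∈ chamberSet q n) :
    ε = ε' ∧ σ = σ' := by
  constructor
  · ext i
    have h1 := abs_of_mem_chamberSet h i
    exact mul_right_cancel₀ (abs_pos.1 h1.2) (h1.1.trans (abs_of_mem_chamberSet h' i).1.symm)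
  · exact Equiv.symm_bijective.1
      (strictAnti_comp_perm_unique (mem_chamberSet_strictAnti h) (mem_chamberSet_strictAnti h'))

lemma exists_mem_chamberSet {q : ℝ≥0∞} {n : ℕ} {x : Fin n → ℝ} (hx : x ∈ lorentzBall q n)
    (h0 : ∀ i, x i ≠ 0) (hinj : Function.Injective fun i => |x i|) :
    ∃ ε σ, (x, ε, σ) ∈ chamberSet q n := by
  let ρ : Equiv.Perm (Fin n) := Fin.revPerm.trans (Tuple.sort fun i => |x i|)
  have hanti : StrictAnti ((fun i => |x i|) ∘ ρ) :=
    ((Tuple.monotone_sort fun i => |x i|).strictMono_of_injective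
      (hinj.comp (Equiv.injective _))).comp_strictAnti Fin.rev_strictAnti
  have hε : ∀ i, SignType.sign (x i) * x i = |x i| := fun i => sign_mul_self (x i)
  refine ⟨fun i => SignType.sign (x i), ρ.symm, fun i => ?_, ?_⟩
  · rcases (h0 i).lt_or_gt with h | h <;> simp [h]
  · simp only [Equiv.symm_symm, hε]
    refine ⟨⟨fun i => abs_pos.2 (h0 _), hanti⟩, ?_⟩
    simpa only [lorentzBall, lorentzNorm, Set.mem_ofPred_eq,
      sortedAbs_eq_of_strictAnti hanti] using hx

lemma ae_ne_zero_and_injective_abs (n : ℕ) : ∀ᵐ x : Fin n → ℝ,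
    (∀ i, x i ≠ 0) ∧ Function.Injective fun i => |x i| := by
  have hker : ∀ f : (Fin n → ℝ) →ₗ[ℝ] ℝ, f ≠ 0 → ∀ᵐ x : Fin n → ℝ, f x ≠ 0 := fun f hf => by
    have := Measure.addHaar_submodule (volume : Measure (Fin n → ℝ)) (LinearMap.ker f)
      (by rwa [Ne, LinearMap.ker_eq_top])
    rw [ae_iff]
    simp only [not_not]
    exact this
  have h1 : ∀ i : Fin n, ∀ᵐ x : Fin n → ℝ, x i ≠ 0 := fun i =>
    hker (LinearMap.proj i) fun h => by
      simpa using congrArg (fun f => f (Pi.single i 1)) h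
  have h2 : ∀ i j : Fin n, ∀ᵐ x : Fin n → ℝ, i ≠ j → |x i| ≠ |x j| := fun i j => by
    by_cases hij : i = j
    · simp [hij]
    let pr : Fin n → (Fin n → ℝ) →ₗ[ℝ] ℝ := LinearMap.proj
    have hne : ∀ c : ℝ, pr i + c • pr j ≠ 0 := fun c h => by
      simpa [pr, Ne.symm hij] using LinearMap.congr_fun h (Pi.single i 1)
    filter_upwards [hker _ (hne 1), hker _ (hne (-1))] with x ha hb _ habs
    rcases abs_eq_abs.1 habs with h | h
    · exact hb (by simp [pr, h])
    · exact ha (by simp [pr, h])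
  filter_upwards [ae_all_iff.2 h1, ae_all_iff.2 fun i => ae_all_iff.2 (h2 i)] with x hx hx'
  exact ⟨hx, fun i j hij => by_contra fun hne => hx' i j hne hij⟩

lemma map_signedPerm_tailMap_apply (q : ℝ≥0∞) {n : ℕ} {ε : Fin n → ℝ}
    (hε : ∀ i, ε i = 1 ∨ ε i = -1) (σ : Equiv.Perm (Fin n)) {A : Set (Fin n → ℝ)}
    (hA : MeasurableSet A) :
    volume ((fun u => signedPerm ε σ (tailMap q n u)) ⁻¹' A ∩ solidSimplex n)
      = ENNReal.ofReal |(LinearMap.det (tailMap q n))⁻¹| *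
        volume (A ∩ {x | (x, ε, σ) ∈ chamberSet q n}) := by
  have hε2 : ∀ i, ε i * ε i = 1 := fun i => by rcases hε i with h | h <;> simp [h]
  have hC : MeasurableSet {x | (x, ε, σ) ∈ chamberSet q n} :=
    measurable_prodMk_right (measurableSet_chamberSet q n)
  have hpre : lorentzChamber q n = signedPerm ε σ ⁻¹' {x | (x, ε, σ) ∈ chamberSet q n} := by
    ext y
    simp [chamberSet, signedPerm, hε, ← mul_assoc, hε2]
  rw [← tailMap_preimage_lorentzChamber q n, ← (measurePreserving_signedPerm hε σ).measure_preimage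
    (hA.inter hC).nullMeasurableSet, Set.preimage_inter, ← hpre,
    ← Measure.addHaar_preimage_linearMap _ (det_tailMap_ne_zero q n)]
  rfl

/-- Theorem A: if `E_1, …, E_{n+1}` are i.i.d. standard exponentials, `ε` is uniform
on `{-1,1}^n`, `π` is uniform on the symmetric group `S_n`, all independent, then the
random vector with `i`-th coordinate `ε_i (∑_{j=π(i)}^n κ_q(j)⁻¹ E_j) / (∑_{j=1}^{n+1} E_j)`
is uniformly distributed on the Lorentz unit ball `B_{q,1}^n`. -/
theorem stochastic_representation_lorentz
    (q : ℝ≥0∞) (hq : 1 ≤ q) (n : ℕ)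
    {Ω : Type*} [MeasurableSpace Ω] (P : Measure Ω) [IsProbabilityMeasure P]
    (E : Ω → Fin (n + 1) → ℝ) (ε : Ω → Fin n → ℝ) (π : Ω → Equiv.Perm (Fin n))
    (hEmeas : Measurable E) (hεmeas : Measurable ε) (hπmeas : Measurable π)
    -- the `E_j` are i.i.d. standard exponential random variables:
    (hE : Measure.map E P = Measure.pi fun _ => ProbabilityTheory.expMeasure 1)
    -- `ε` is uniformly distributed on `{-1,1}^n`:
    (hε : Measure.map ε P
      = Measure.pi fun _ => (2 : ℝ≥0∞)⁻¹ • (Measure.dirac (-1 : ℝ) + Measure.dirac (1 : ℝ)))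
    -- `π` is uniformly distributed on the symmetric group `S_n`:
    (hπ : ∀ σ : Equiv.Perm (Fin n), Measure.map π P {σ} = (Nat.factorial n : ℝ≥0∞)⁻¹)
    -- `E`, `ε` and `π` are independent of each other:
    (hindep : Measure.map (fun ω => (E ω, ε ω, π ω)) P
      = (Measure.map E P).prod ((Measure.map ε P).prod (Measure.map π P))) :
    Measure.map (fun ω (i : Fin n) =>
        ε ω i *
          (∑ j : Fin n, if (π ω i : ℕ) ≤ (j : ℕ)
            then (kappa q ((j : ℕ) + 1))⁻¹ * E ω j.castSucc else 0)
          / ∑ j : Fin (n + 1), E ω j) P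
      = (volume (lorentzBall q n))⁻¹ • volume.restrict (lorentzBall q n) := by
  obtain ⟨c, hc⟩ := map_exp_normalized (n := n)
  set norm : (Fin (n + 1) → ℝ) → Fin n → ℝ := fun e i => e i.castSucc / ∑ j, e j with hnorm
  have hnorm_meas : Measurable norm := measurable_pi_lambda _ fun i => by fun_prop
  let Φ : (Fin (n + 1) → ℝ) × (Fin n → ℝ) × Equiv.Perm (Fin n) → Fin n → ℝ :=
    fun p => signedPerm p.2.1 p.2.2 (tailMap q n (norm p.1))
  have hΦ_meas : Measurable Φ := by
    have htail : Measurable (tailMap q n) := (tailMap q n).continuous_of_finiteDimensional.measurable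
    refine measurable_pi_lambda _ fun i => Measurable.mul (by fun_prop) ?_
    exact measurable_apply_perm (f := fun p : (Fin (n + 1) → ℝ) × (Fin n → ℝ) ×
      Equiv.Perm (Fin n) => tailMap q n (norm p.1)) (g := fun p => p.2.2.symm)
      (htail.comp (hnorm_meas.comp measurable_fst))
      ((show Measurable (Equiv.symm : Equiv.Perm (Fin n) → Equiv.Perm (Fin n)) from
        fun _ _ => trivial).comp (measurable_snd.comp measurable_snd)) i
  have hX : (fun ω (i : Fin n) => ε ω i *
      (∑ j : Fin n, if (π ω i : ℕ) ≤ (j : ℕ)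
        then (kappa q ((j : ℕ) + 1))⁻¹ * E ω j.castSucc else 0)
      / ∑ j : Fin (n + 1), E ω j) = Φ ∘ fun ω => (E ω, ε ω, π ω) := by
    ext ω i
    simp only [Φ, Function.comp_apply, signedPerm, tailMap_apply, weightedTail, hnorm]
    rw [mul_div_assoc, Finset.sum_div]
    congr 1
    exact Finset.sum_congr rfl fun j _ => by split_ifs <;> ring
  have htriple : Measurable fun ω => (E ω, ε ω, π ω) := by fun_prop
  have := Measure.isProbabilityMeasure_map hEmeas.aemeasurable (μ := P)
  have := Measure.isProbabilityMeasure_map hεmeas.aemeasurable (μ := P)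
  have := Measure.isProbabilityMeasure_map hπmeas.aemeasurable (μ := P)
  have hprob : IsProbabilityMeasure (Measure.map (Φ ∘ fun ω => (E ω, ε ω, π ω)) P) :=
    Measure.isProbabilityMeasure_map (hΦ_meas.comp htriple).aemeasurable
  rw [hX]
  set ν := (Measure.map ε P).prod (Measure.map π P) with hν
  have hfin : IsFiniteMeasure
      ((2 : ℝ≥0∞)⁻¹ • (Measure.dirac (-1 : ℝ) + Measure.dirac (1 : ℝ))) :=
    Measure.smul_finite _ (by simp)
  have hsigns : ∀ᵐ p ∂ν, ∀ i, p.1 i = 1 ∨ p.1 i = -1 := by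
    refine Measure.quasiMeasurePreserving_fst.ae (p := fun e : Fin n → ℝ =>
      ∀ i, e i = 1 ∨ e i = -1) ?_
    rw [hε, ae_all_iff]
    intro i
    refine Measure.tendsto_eval_ae_ae.eventually (p := fun t : ℝ => t = 1 ∨ t = -1) ?_
    refine Measure.ae_smul_measure ?_ _
    rw [ae_add_measure_iff, ae_dirac_eq, ae_dirac_eq]
    simp
  set w : ℝ≥0∞ := (2⁻¹ : ℝ≥0∞) ^ n * (Nat.factorial n : ℝ≥0∞)⁻¹ with hw
  let B : Set (Fin n → ℝ) := {x | ν {p | (x, p) ∈ chamberSet q n} ≠ 0}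
  have hν_meas : Measurable fun x => ν {p | (x, p) ∈ chamberSet q n} :=
    measurable_measure_prodMk_left (measurableSet_chamberSet q n)
  have hB_meas : MeasurableSet B := (hν_meas (measurableSet_singleton 0)).compl
  have hν_of_mem : ∀ x e σ, (x, e, σ) ∈ chamberSet q n →
      ν {p | (x, p) ∈ chamberSet q n} = w := by
    intro x e σ h
    have hset : {p | (x, p) ∈ chamberSet q n} = ({e} : Set (Fin n → ℝ)) ×ˢ {σ} := by
      ext ⟨e', σ'⟩
      simp only [Set.mem_ofPred_eq, Set.mem_prod, Set.mem_singleton_iff]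
      refine ⟨fun h' => chamberSet_unique h' h, ?_⟩
      rintro ⟨rfl, rfl⟩
      exact h
    rw [hset, hν, Measure.prod_prod, hπ, hε, Measure.pi_singleton, hw]
    congr 1
    have h2 : ∀ i, ((2 : ℝ≥0∞)⁻¹ • (Measure.dirac (-1 : ℝ) + Measure.dirac (1 : ℝ))) {e i}
        = 2⁻¹ := fun i => by
      rcases h.1 i with h | h <;> simp only at h <;> simp [h] <;> norm_num
    rw [Finset.prod_congr rfl fun i _ => h2 i]
    simp
  have hw0 : w ≠ 0 := by
    simp [hw]
  have hν_eq : ∀ x, ν {p | (x, p) ∈ chamberSet q n} = B.indicator (fun _ => w) x := by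
    intro x
    by_cases hx : x ∈ B
    · rw [Set.indicator_of_mem hx]
      obtain ⟨⟨e, σ⟩, h⟩ := nonempty_of_measure_ne_zero hx
      exact hν_of_mem x e σ h
    · rw [Set.indicator_of_notMem hx]
      simpa [B] using hx
  have hB : B =ᵐ[volume] lorentzBall q n := by
    filter_upwards [ae_ne_zero_and_injective_abs n] with x hx
    refine propext ⟨fun h => ?_, fun h => ?_⟩
    · obtain ⟨⟨e, σ⟩, h⟩ := nonempty_of_measure_ne_zero (show ν _ ≠ 0 from h)
      exact mem_lorentzBall_of_mem_chamberSet h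
    · obtain ⟨e, σ, h⟩ := exists_mem_chamberSet h hx.1 hx.2
      exact (hν_of_mem x e σ h).trans_ne hw0
  set d := ENNReal.ofReal |(LinearMap.det (tailMap q n))⁻¹|
  have hlaw : Measure.map (Φ ∘ fun ω => (E ω, ε ω, π ω)) P
      = (c * d * w) • volume.restrict (lorentzBall q n) := by
    ext A hA
    have hind : MeasurableSet {z : ((Fin n → ℝ) × Equiv.Perm (Fin n)) × (Fin n → ℝ) |
        z.2 ∈ A ∧ (z.2, z.1) ∈ chamberSet q n} :=
      (measurable_snd hA).inter (measurable_swap (measurableSet_chamberSet q n))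
    calc Measure.map (Φ ∘ fun ω => (E ω, ε ω, π ω)) P A
        = ∫⁻ p, (Measure.map E P) {e | Φ (e, p) ∈ A} ∂ν := by
          rw [← Measure.map_map hΦ_meas htriple, hindep, Measure.map_apply hΦ_meas hA,
            Measure.prod_apply_symm (hΦ_meas hA)]
          rfl
      _ = ∫⁻ p, c * d * volume {x | x ∈ A ∧ (x, p) ∈ chamberSet q n} ∂ν := by
          refine lintegral_congr_ae ?_
          filter_upwards [hsigns] with p hp
          have hm : Measurable fun u => signedPerm p.1 p.2 (tailMap q n u) :=
            (measurePreserving_signedPerm hp p.2).measurable.comp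
              (tailMap q n).continuous_of_finiteDimensional.measurable
          have h := map_signedPerm_tailMap_apply q hp p.2 hA
          rw [← Measure.restrict_apply (hm hA)] at h
          calc (Measure.map E P) {e | Φ (e, p) ∈ A}
              = (c • volume.restrict (solidSimplex n))
                ((fun u => signedPerm p.1 p.2 (tailMap q n u)) ⁻¹' A) := by
                rw [← hc, Measure.map_apply hnorm_meas (hm hA), hE]
                rfl
            _ = _ := by
                rw [Measure.smul_apply, h, smul_eq_mul, mul_assoc]
                rfl
      _ = c * d * ∫⁻ x, A.indicator (fun x => ν {p | (x, p) ∈ chamberSet q n}) x := by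
          have hm : Measurable fun p => volume {x | x ∈ A ∧ (x, p) ∈ chamberSet q n} :=
            measurable_measure_prodMk_left hind
          rw [lintegral_const_mul _ hm]
          congr 1
          have h1 := Measure.prod_apply (μ := ν) (ν := (volume : Measure (Fin n → ℝ))) hind
          have h2 := Measure.prod_apply_symm (μ := ν) (ν := (volume : Measure (Fin n → ℝ))) hind
          refine (h1.symm.trans h2).trans (lintegral_congr fun x => ?_)
          by_cases hx : x ∈ A <;> simp [hx]
      _ = c * d * w * volume (A ∩ B) := by
          rw [lintegral_congr fun x => by
            rw [show A.indicator (fun x => ν {p | (x, p) ∈ chamberSet q n}) x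
              = (A ∩ B).indicator (fun _ => w) x by
                simp only [hν_eq, ← Set.indicator_indicator]],
            lintegral_indicator_const (hA.inter hB_meas), mul_assoc (c * d)]
      _ = _ := by
          rw [Measure.smul_apply, smul_eq_mul, ← Measure.restrict_congr_set hB,
            Measure.restrict_apply hA]
  have hmass := hprob.measure_univ
  rw [hlaw, Measure.smul_apply, Measure.restrict_apply_univ, smul_eq_mul] at hmass
  rw [hlaw, ENNReal.eq_inv_of_mul_eq_one_left hmass]

end
end

section
/- For q = ∞, let X̃^{(n)} = (X̃_1^{(n)},…,X̃_n^{(n)}) be uniformly distributed on D̃_{∞,1}^n = log(n+1) · B_{∞,1}^n for each n. Then for every bounded continuous function f : ℝ → ℝ, the empirical average (1/n) Σ_{i=1}^n f(X̃_i^{(n)}) converges in probability, as n → ∞, to (1/2)∫_{-1}^{1} f(x) dx, i.e., the limiting distribution is the uniform distribution on [-1,1]. -/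
open MeasureTheory Finset Filter
open scoped ENNReal NNReal

noncomputable section

/-- The Lorentz norm `‖x‖_{∞,1} = ∑_{i=1}^n i⁻¹ x_i^*`. -/
def lorentzNormInf {n : ℕ} (x : Fin n → ℝ) : ℝ :=
  ∑ i : Fin n, ((i : ℝ) + 1)⁻¹ * sortedAbs x i

/-- The unit ball of the Lorentz space `ℓ_{∞,1}^n`. -/
def lorentzBallInf (n : ℕ) : Set (Fin n → ℝ) :=
  {x | lorentzNormInf x ≤ 1}

/-- The normalized Lorentz ball `D̃_{∞,1}^n = log(n+1) · B_{∞,1}^n`. -/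
def scaledLorentzBallInf (n : ℕ) : Set (Fin n → ℝ) :=
  (fun x => (Real.log ((n : ℝ) + 1)) • x) '' lorentzBallInf n

/-- The uniform probability measure on a set (normalized restricted Lebesgue measure). -/
def unifOn {n : ℕ} (s : Set (Fin n → ℝ)) : Measure (Fin n → ℝ) :=
  (volume s)⁻¹ • volume.restrict s

theorem harmonic_card_lt_abs_mul_le {n : ℕ} (y : Fin n → ℝ) (τ : ℝ) :
    τ * (harmonic #{j | τ < |y j|} : ℝ) ≤ lorentzNormInf y := by
  set k := #{j | τ < |y j|} with hk
  set T : Finset (Fin n) := {i | τ < sortedAbs y i} with hT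
  have hanti : Antitone (sortedAbs y) := by
    intro a b hab
    exact Tuple.monotone_sort (fun j => |y j|) (Fin.rev_le_rev.mpr hab)
  have hcard : #T = k := by
    refine Finset.card_equiv (Fin.revPerm.trans (Tuple.sort fun j => |y j|)) fun i => ?_
    rw [hT, Finset.mem_filter, Finset.mem_filter]
    simp [sortedAbs]
  have hinit : ∀ i : Fin n, (i : ℕ) < k → τ < sortedAbs y i := by
    intro i hi
    by_contra hnot
    have hsub : T ⊆ Finset.Iio i := by
      intro j hj
      simp only [hT, Finset.mem_filter, Finset.mem_univ, true_and] at hj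
      rw [Finset.mem_Iio]
      by_contra hij
      exact hnot (hj.trans_le (hanti (not_lt.mp hij)))
    have := Finset.card_le_card hsub
    rw [Fin.card_Iio, hcard] at this
    omega
  have hkn : k ≤ n := by simpa using Finset.card_filter_le (univ : Finset (Fin n)) fun j => τ < |y j|
  have hharm : (harmonic k : ℝ) = ∑ i : Fin n, if (i : ℕ) < k then ((i : ℝ) + 1)⁻¹ else 0 := by
    rw [Fin.sum_univ_eq_sum_range (fun i => if i < k then ((i : ℝ) + 1)⁻¹ else 0) n,
      ← Finset.sum_filter]
    have : {i ∈ Finset.range n | i < k} = Finset.range k := by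
      ext i; simp; omega
    rw [this]
    simp [harmonic]
  rw [hharm, Finset.mul_sum]
  refine Finset.sum_le_sum fun i _ => ?_
  have hpos : (0 : ℝ) ≤ ((i : ℝ) + 1)⁻¹ := by positivity
  split_ifs with hi
  · rw [mul_comm]
    exact mul_le_mul_of_nonneg_left (hinit i hi).le hpos
  · rw [mul_zero]
    exact mul_nonneg hpos (abs_nonneg _)

theorem mul_harmonic_card_le_of_mem_scaledLorentzBallInf {n : ℕ} {x : Fin n → ℝ}
    (hn : 1 ≤ n) (hx : x ∈ scaledLorentzBallInf n) (R : ℝ) :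
    R * (harmonic #{j | R < |x j|} : ℝ) ≤ Real.log ((n : ℝ) + 1) := by
  obtain ⟨y, hy, rfl⟩ := hx
  have hL : 0 < Real.log ((n : ℝ) + 1) := by
    apply Real.log_pos
    have : (1 : ℝ) ≤ n := by exact_mod_cast hn
    linarith
  set L := Real.log ((n : ℝ) + 1)
  have h := (harmonic_card_lt_abs_mul_le y (R / L)).trans hy
  have hset : ∀ j, R < |(L • y) j| ↔ R / L < |y j| := by
    intro j
    rw [Pi.smul_apply, smul_eq_mul, abs_mul, abs_of_pos hL, div_lt_iff₀' hL]
  simp only [hset]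
  rwa [div_mul_eq_mul_div, div_le_one hL] at h

theorem abs_le_of_mem_scaledLorentzBallInf {n : ℕ} {x : Fin n → ℝ}
    (hn : 1 ≤ n) (hx : x ∈ scaledLorentzBallInf n) (j : Fin n) :
    |x j| ≤ Real.log ((n : ℝ) + 1) := by
  refine le_of_forall_lt fun R hR => ?_
  have hpos : 0 < Real.log ((n : ℝ) + 1) := by
    apply Real.log_pos
    have : (1 : ℝ) ≤ n := by exact_mod_cast hn
    linarith
  rcases lt_or_ge R 0 with h0 | h0
  · exact h0.trans hpos
  obtain ⟨S, hRS, hS⟩ := exists_between hR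
  have h := mul_harmonic_card_le_of_mem_scaledLorentzBallInf hn hx S
  have hk : 1 ≤ #{j | S < |x j|} :=
    Finset.card_pos.mpr ⟨j, by simpa using hS⟩
  have hharm : (1 : ℝ) ≤ (harmonic #{j | S < |x j|} : ℝ) := by
    have : (1 : ℚ) ≤ harmonic #{j | S < |x j|} := by
      rw [harmonic, ← Finset.sum_range_add_sum_Ico _ hk]
      simp only [Finset.sum_range_one]
      norm_num
      exact Finset.sum_nonneg fun i _ => by positivity
    exact_mod_cast this
  calc R < S := hRS
    _ ≤ S * _ := le_mul_of_one_le_right (h0.trans hRS.le) hharm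
    _ ≤ _ := h

theorem card_lt_abs_le_of_mem_scaledLorentzBallInf {n : ℕ} {x : Fin n → ℝ}
    (hn : 1 ≤ n) (hx : x ∈ scaledLorentzBallInf n) {R : ℝ} (hR : 0 < R) :
    (#{j | R < |x j|} : ℝ) ≤ Real.exp (Real.log ((n : ℝ) + 1) / R) := by
  have h := mul_harmonic_card_le_of_mem_scaledLorentzBallInf hn hx R
  have hlog := log_add_one_le_harmonic #{j | R < |x j|}
  push_cast at hlog
  have h2 : Real.log ((#{j | R < |x j|} : ℝ) + 1) ≤ Real.log ((n : ℝ) + 1) / R := by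
    rw [le_div_iff₀ hR, mul_comm]
    exact (mul_le_mul_of_nonneg_left hlog hR.le).trans h
  rw [Real.log_le_iff_le_exp (by positivity)] at h2
  linarith

theorem Icc_subset_scaledLorentzBallInf {n : ℕ} (hn : 1 ≤ n) {b : ℝ}
    (h : b * (harmonic n : ℝ) ≤ Real.log ((n : ℝ) + 1)) :
    Set.Icc (fun _ => -b) (fun _ => b) ⊆ scaledLorentzBallInf n := by
  intro x hx
  have hL : 0 < Real.log ((n : ℝ) + 1) := by
    apply Real.log_pos
    have : (1 : ℝ) ≤ n := by exact_mod_cast hn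
    linarith
  set L := Real.log ((n : ℝ) + 1)
  refine ⟨L⁻¹ • x, ?_, by simp [smul_smul, L, hL.ne']⟩
  have hs : ∀ i, sortedAbs (L⁻¹ • x) i ≤ b / L := by
    intro i
    simp only [sortedAbs, Pi.smul_apply, smul_eq_mul, abs_mul, abs_inv, abs_of_pos hL]
    rw [inv_mul_eq_div]
    gcongr
    exact abs_le.mpr ⟨hx.1 _, hx.2 _⟩
  have hharm : ∑ i : Fin n, ((i : ℝ) + 1)⁻¹ = (harmonic n : ℝ) := by
    rw [Fin.sum_univ_eq_sum_range (fun i => ((i : ℝ) + 1)⁻¹) n]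
    simp [harmonic]
  calc lorentzNormInf (L⁻¹ • x) ≤ ∑ i : Fin n, ((i : ℝ) + 1)⁻¹ * (b / L) :=
        Finset.sum_le_sum fun i _ => mul_le_mul_of_nonneg_left (hs i) (by positivity)
    _ = b * (harmonic n : ℝ) / L := by rw [← Finset.sum_mul, hharm]; ring
    _ ≤ 1 := (div_le_one hL).mpr h

theorem ofReal_pow_le_volume_scaledLorentzBallInf {n : ℕ} (hn : 1 ≤ n) {b : ℝ} (hb : 0 ≤ b)
    (h : b * (harmonic n : ℝ) ≤ Real.log ((n : ℝ) + 1)) :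
    ENNReal.ofReal ((2 * b) ^ n) ≤ volume (scaledLorentzBallInf n) := by
  refine le_trans (le_of_eq ?_) (measure_mono (Icc_subset_scaledLorentzBallInf hn h))
  rw [Real.volume_Icc_pi, ENNReal.ofReal_pow (by positivity)]
  simp [two_mul]

theorem volume_le_of_one_le_prod {n : ℕ} {A : Set (Fin n → ℝ)} {h : ℝ → ℝ} (hi : Integrable h)
    (h0 : ∀ t, 0 ≤ h t) {c : ℝ} (hc : 0 ≤ c) (hA : ∀ x ∈ A, 1 ≤ c * ∏ i, h (x i)) :
    volume A ≤ ENNReal.ofReal (c * (∫ t, h t) ^ n) := by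
  have hiprod : Integrable fun x : Fin n → ℝ => c * ∏ i, h (x i) :=
    (Integrable.fintype_prod (f := fun _ : Fin n => h) fun _ => hi).const_mul _
  have hpow := integral_fintype_prod_volume_eq_pow (ι := Fin n) h
  rw [Fintype.card_fin] at hpow
  rw [← hpow, ← integral_const_mul, ofReal_integral_eq_lintegral_ofReal hiprod
    (.of_forall fun x => mul_nonneg hc (Finset.prod_nonneg fun i _ => h0 _))]
  exact meas_le_lintegral₀ hiprod.aestronglyMeasurable.aemeasurable.ennreal_ofReal
    fun x hx => by simpa using ENNReal.ofReal_le_ofReal (hA x hx)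

/-- An exponential Chebyshev bound for the volume of a set of vectors having few coordinates
outside `[-R, R]`. -/
theorem volume_le_exp_mul_pow {n : ℕ} {A : Set (Fin n → ℝ)} {g : ℝ → ℝ} (hg : Continuous g)
    {B lam R L κ K : ℝ} (hB : ∀ t, |g t| ≤ B) (hlam : 0 ≤ lam) (hR : 0 ≤ R) (hL : 0 ≤ L)
    (hκ : 0 ≤ κ) (hsum : ∀ x ∈ A, 0 ≤ ∑ i, g (x i)) (hbound : ∀ x ∈ A, ∀ i, |x i| ≤ L)
    (hcard : ∀ x ∈ A, (#{i | R < |x i|} : ℝ) ≤ K) :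
    volume A ≤ ENNReal.ofReal (Real.exp (κ * K) *
      ((∫ t in (-R)..R, Real.exp (lam * g t)) + 2 * L * Real.exp (lam * B - κ)) ^ n) := by
  set h₁ : ℝ → ℝ := (Set.Icc (-R) R).indicator fun t => Real.exp (lam * g t)
  set h₂ : ℝ → ℝ := (Set.Icc (-L) L).indicator fun _ => Real.exp (lam * B - κ)
  have hcont : Continuous fun t => Real.exp (lam * g t) := by fun_prop
  have hi₁ : Integrable h₁ := (integrable_indicator_iff measurableSet_Icc).mpr
    hcont.continuousOn.integrableOn_Icc
  have hi₂ : Integrable h₂ := (integrable_indicator_iff measurableSet_Icc).mpr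
    continuous_const.continuousOn.integrableOn_Icc
  have h₁0 : ∀ t, 0 ≤ h₁ t := Set.indicator_nonneg fun _ _ => (Real.exp_pos _).le
  have h₂0 : ∀ t, 0 ≤ h₂ t := Set.indicator_nonneg fun _ _ => (Real.exp_pos _).le
  have hint : ∫ t, (h₁ t + h₂ t) =
      (∫ t in (-R)..R, Real.exp (lam * g t)) + 2 * L * Real.exp (lam * B - κ) := by
    rw [integral_add hi₁ hi₂, integral_indicator measurableSet_Icc,
      integral_indicator measurableSet_Icc, integral_Icc_eq_integral_Ioc,
      ← intervalIntegral.integral_of_le (by linarith), setIntegral_const]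
    congr 1
    rw [Measure.real, Real.volume_Icc, ENNReal.toReal_ofReal (by linarith), smul_eq_mul]
    ring
  have hpoint : ∀ x ∈ A, 1 ≤ Real.exp (κ * K) * ∏ i, (h₁ (x i) + h₂ (x i)) := by
    intro x hx
    have hle : ∀ i, Real.exp (lam * g (x i) - if R < |x i| then κ else 0) ≤
        h₁ (x i) + h₂ (x i) := by
      intro i
      split_ifs with hi
      · have : h₂ (x i) = Real.exp (lam * B - κ) :=
          Set.indicator_of_mem (Set.mem_Icc.mpr (abs_le.mp (hbound x hx i))) _
        rw [this]
        refine le_trans (Real.exp_le_exp.mpr ?_) (le_add_of_nonneg_left (h₁0 _))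
        have := mul_le_mul_of_nonneg_left ((le_abs_self _).trans (hB (x i))) hlam
        linarith
      · have : h₁ (x i) = Real.exp (lam * g (x i)) :=
          Set.indicator_of_mem (Set.mem_Icc.mpr (abs_le.mp (not_lt.mp hi))) _
        rw [this, sub_zero]
        exact le_add_of_nonneg_right (h₂0 _)
    have hprod : Real.exp (-(κ * K)) ≤ ∏ i, (h₁ (x i) + h₂ (x i)) := by
      refine le_trans ?_ (Finset.prod_le_prod (fun i _ => (Real.exp_pos _).le) fun i _ => hle i)
      rw [← Real.exp_sum, Real.exp_le_exp, Finset.sum_sub_distrib, ← Finset.mul_sum,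
        ← Finset.sum_filter, Finset.sum_const, nsmul_eq_mul]
      have h1 := mul_nonneg hlam (hsum x hx)
      have h2 := mul_le_mul_of_nonneg_left (hcard x hx) hκ
      linarith
    calc (1 : ℝ) = Real.exp (κ * K) * Real.exp (-(κ * K)) := by
          rw [← Real.exp_add, add_neg_cancel, Real.exp_zero]
      _ ≤ _ := mul_le_mul_of_nonneg_left hprod (Real.exp_pos _).le
  have hvol := volume_le_of_one_le_prod (hi₁.add hi₂) (fun t => add_nonneg (h₁0 t) (h₂0 t))
    (Real.exp_pos _).le hpoint
  simp only [Pi.add_apply] at hvol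
  rwa [hint] at hvol

theorem exists_integral_exp_lt_two {g : ℝ → ℝ} (hg : Continuous g) {B : ℝ} (hB : ∀ t, |g t| ≤ B)
    (hneg : ∫ t in (-1)..1, g t < 0) :
    ∃ lam > 0, ∃ R > 1, ∫ t in (-R)..R, Real.exp (lam * g t) < 2 := by
  set m := ∫ t in (-1 : ℝ)..1, g t
  have hB0 : 0 ≤ B := (abs_nonneg _).trans (hB 0)
  obtain ⟨lam, hlam, hlamB, hlamm⟩ : ∃ lam > 0, lam * B ≤ 1 ∧ 2 * lam * B ^ 2 < -m := by
    have h1 : ∀ᶠ lam : ℝ in nhdsWithin 0 (Set.Ioi 0), lam * B < 1 :=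
      ((continuous_id.mul continuous_const).tendsto' 0 0 (by simp)).eventually_lt_const one_pos
        |>.filter_mono nhdsWithin_le_nhds
    have h2 : ∀ᶠ lam : ℝ in nhdsWithin 0 (Set.Ioi 0), 2 * lam * B ^ 2 < -m :=
      ((by fun_prop : Continuous fun lam : ℝ => 2 * lam * B ^ 2).tendsto' 0 0
        (by simp)).eventually_lt_const (neg_pos.mpr hneg) |>.filter_mono nhdsWithin_le_nhds
    obtain ⟨lam, ⟨ha, hb⟩, hc⟩ := ((h1.and h2).and self_mem_nhdsWithin).exists
    exact ⟨lam, hc, ha.le, hb⟩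
  have hcont : Continuous fun t => Real.exp (lam * g t) := by fun_prop
  have hone : ∫ t in (-1 : ℝ)..1, Real.exp (lam * g t) < 2 := by
    have hle : ∀ t, Real.exp (lam * g t) ≤ 1 + lam ^ 2 * B ^ 2 + lam * g t := by
      intro t
      have habs : |lam * g t| ≤ lam * B := by
        rw [abs_mul, abs_of_pos hlam]
        exact mul_le_mul_of_nonneg_left (hB t) hlam.le
      have h1 := (abs_le.mp (Real.abs_exp_sub_one_sub_id_le (habs.trans hlamB))).2
      have h2 : (lam * g t) ^ 2 ≤ (lam * B) ^ 2 := sq_le_sq' (abs_le.mp habs).1 (abs_le.mp habs).2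
      rw [mul_pow lam B] at h2
      linarith
    have hgi : IntervalIntegrable (fun t => lam * g t) volume (-1) 1 :=
      (continuous_const.mul hg).intervalIntegrable _ _
    calc ∫ t in (-1 : ℝ)..1, Real.exp (lam * g t)
        ≤ ∫ t in (-1 : ℝ)..1, (1 + lam ^ 2 * B ^ 2 + lam * g t) :=
          intervalIntegral.integral_mono_on (by norm_num) (hcont.intervalIntegrable _ _)
            ((by fun_prop : Continuous fun t => 1 + lam ^ 2 * B ^ 2 + lam * g t).intervalIntegrable
              _ _) fun t _ => hle t
      _ = 2 * (1 + lam ^ 2 * B ^ 2) + lam * m := by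
          rw [intervalIntegral.integral_add (by simp) hgi, intervalIntegral.integral_const,
            intervalIntegral.integral_const_mul, smul_eq_mul]
          ring
      _ < 2 := by nlinarith
  have hRcont : Continuous fun R : ℝ => ∫ t in (-R)..R, Real.exp (lam * g t) := by
    have hp := intervalIntegral.continuous_primitive
      (fun a b => hcont.intervalIntegrable (μ := volume) a b) 0
    have : (fun R : ℝ => ∫ t in (-R)..R, Real.exp (lam * g t)) = fun R =>
        (∫ t in (0 : ℝ)..R, Real.exp (lam * g t)) - ∫ t in (0 : ℝ)..(-R), Real.exp (lam * g t) := by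
      funext R
      rw [intervalIntegral.integral_interval_sub_left] <;> exact hcont.intervalIntegrable _ _
    rw [this]
    exact hp.sub (hp.comp continuous_neg)
  have hev : ∀ᶠ R : ℝ in nhdsWithin 1 (Set.Ioi 1), ∫ t in (-R)..R, Real.exp (lam * g t) < 2 :=
    (hRcont.tendsto 1).eventually_lt_const hone |>.filter_mono nhdsWithin_le_nhds
  obtain ⟨R, hR, hR1⟩ := (hev.and self_mem_nhdsWithin).exists
  exact ⟨lam, hlam, R, hR1, hR⟩

theorem tendsto_exp_sub_mul_exp_nhds_zero {R c : ℝ} (hR : 1 < R) (hc : 0 < c) :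
    Tendsto (fun L : ℝ => Real.exp (2 * Real.log L * Real.exp (L / R) - c * (Real.exp L - 1)))
      atTop (nhds 0) := by
  have hs : 0 < 1 - 1 / R := by
    have : 1 / R < 1 := (div_lt_one (by linarith)).mpr hR
    linarith
  have hlim : Tendsto (fun L : ℝ => L * Real.exp (-((1 - 1 / R) * L))) atTop (nhds 0) := by
    have h := (Real.tendsto_pow_mul_exp_neg_atTop_nhds_zero 1).comp
      (tendsto_id.const_mul_atTop hs)
    have h' := h.const_mul (1 - 1 / R)⁻¹
    rw [mul_zero] at h'
    refine h'.congr fun L => ?_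
    simp only [Function.comp, id, pow_one]
    rw [← mul_assoc, inv_mul_cancel_left₀ hs.ne']
  have hev : ∀ᶠ L : ℝ in atTop,
      2 * Real.log L * Real.exp (L / R) - c * (Real.exp L - 1) ≤ c - c / 2 * Real.exp L := by
    filter_upwards [hlim.eventually_le_const (by positivity : 0 < c / 4), eventually_gt_atTop 0]
      with L hL hL0
    have hsplit : L * Real.exp (L / R) = L * Real.exp (-((1 - 1 / R) * L)) * Real.exp L := by
      rw [mul_assoc, ← Real.exp_add]
      congr 2
      ring
    have h1 : L * Real.exp (L / R) ≤ c / 4 * Real.exp L := by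
      rw [hsplit]
      exact mul_le_mul_of_nonneg_right hL (Real.exp_pos _).le
    have h2 : Real.log L * Real.exp (L / R) ≤ L * Real.exp (L / R) :=
      mul_le_mul_of_nonneg_right (Real.log_le_self hL0.le) (Real.exp_pos _).le
    linarith
  refine Real.tendsto_exp_atBot.comp (tendsto_atBot_mono' _ hev ?_)
  refine tendsto_atBot_add_const_left _ c (tendsto_neg_atTop_atBot.comp
    (Real.tendsto_exp_atTop.const_mul_atTop (by positivity : 0 < c / 2))) |>.congr fun L => ?_
  simp [sub_eq_add_neg]

theorem tendsto_unifOn_scaledLorentzBallInf_sum_nonneg {g : ℝ → ℝ} (hg : Continuous g)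
    {B : ℝ} (hB : ∀ t, |g t| ≤ B) (hneg : ∫ t in (-1)..1, g t < 0) :
    Tendsto (fun n : ℕ => unifOn (scaledLorentzBallInf n) {x | 0 ≤ ∑ i, g (x i)})
      atTop (nhds 0) := by
  obtain ⟨lam, hlam, R, hR, hI⟩ := exists_integral_exp_lt_two hg hB hneg
  set I := ∫ t in (-R)..R, Real.exp (lam * g t) with hIdef
  have hI0 : 0 ≤ I := intervalIntegral.integral_nonneg (by linarith) fun t _ => (Real.exp_pos _).le
  obtain ⟨r, hIr, hr⟩ := exists_between hI
  have hr0 : 0 < r := hI0.trans_lt hIr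
  obtain ⟨d, hrd, hd⟩ := exists_between hr
  have hd0 : 0 < d := hr0.trans hrd
  have hc : 0 < -Real.log (r / d) :=
    neg_pos.mpr (Real.log_neg (div_pos hr0 hd0) ((div_lt_one hd0).mpr hrd))
  have hLtop : Tendsto (fun n : ℕ => Real.log ((n : ℝ) + 1)) atTop atTop :=
    Real.tendsto_log_atTop.comp (tendsto_atTop_add_const_right _ _ tendsto_natCast_atTop_atTop)
  have hlim := (tendsto_exp_sub_mul_exp_nhds_zero hR hc).comp hLtop
  have hsmall : ∀ᶠ L : ℝ in atTop, 2 * Real.exp (lam * B) / L ≤ r - I :=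
    (tendsto_const_nhds.div_atTop tendsto_id).eventually_le_const (sub_pos.mpr hIr)
  have hbox : ∀ᶠ L : ℝ in atTop, d / 2 * (1 + L) ≤ L := by
    filter_upwards [eventually_ge_atTop ((d / 2) / (1 - d / 2))] with L hL
    rw [div_le_iff₀ (by linarith)] at hL
    linarith
  have hlim' := ENNReal.tendsto_ofReal hlim
  rw [ENNReal.ofReal_zero] at hlim'
  refine tendsto_of_tendsto_of_tendsto_of_le_of_le' tendsto_const_nhds hlim'
    (.of_forall fun _ => zero_le) ?_
  filter_upwards [hLtop.eventually hsmall, hLtop.eventually hbox, eventually_ge_atTop 1,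
    hLtop.eventually (eventually_ge_atTop 1)] with n hn1 hn2 hn hL1
  have hexp : Real.exp (Real.log ((n : ℝ) + 1)) = n + 1 := Real.exp_log (by positivity)
  have hharm : d / 2 * (harmonic n : ℝ) ≤ Real.log ((n : ℝ) + 1) := by
    refine le_trans (mul_le_mul_of_nonneg_left ((harmonic_le_one_add_log n).trans ?_)
      (by positivity)) hn2
    gcongr
    linarith
  have hvol := ofReal_pow_le_volume_scaledLorentzBallInf hn (by positivity) hharm
  rw [mul_div_cancel₀ _ (two_ne_zero' ℝ)] at hvol
  simp only [Function.comp_apply]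
  set L := Real.log ((n : ℝ) + 1) with hLdef
  have hL0 : 0 < L := by linarith
  have hmeas : MeasurableSet {x : Fin n → ℝ | 0 ≤ ∑ i, g (x i)} :=
    (isClosed_le continuous_const (by fun_prop)).measurableSet
  have hbad := volume_le_exp_mul_pow (A := {x | 0 ≤ ∑ i, g (x i)} ∩ scaledLorentzBallInf n) hg hB
    hlam.le (by linarith : 0 ≤ R) hL0.le
    (mul_nonneg zero_le_two (Real.log_nonneg hL1)) (fun x hx => hx.1)
    (fun x hx => abs_le_of_mem_scaledLorentzBallInf hn hx.2)
    (fun x hx => card_lt_abs_le_of_mem_scaledLorentzBallInf hn hx.2 (by linarith))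
  rw [← hIdef, ← hLdef] at hbad
  have hE : 2 * L * Real.exp (lam * B - 2 * Real.log L) ≤ r - I := by
    refine le_trans (le_of_eq ?_) hn1
    rw [Real.exp_sub, two_mul (Real.log L), Real.exp_add, Real.exp_log hL0]
    field_simp
  have hpow : (I + 2 * L * Real.exp (lam * B - 2 * Real.log L)) ^ n ≤ r ^ n :=
    pow_le_pow_left₀ (by positivity) (by linarith) n
  rw [unifOn, Measure.smul_apply, Measure.restrict_apply hmeas, smul_eq_mul]
  calc _ ≤ (ENNReal.ofReal (d ^ n))⁻¹ *
        ENNReal.ofReal (Real.exp (2 * Real.log L * Real.exp (L / R)) * r ^ n) := by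
        gcongr
        exact hbad.trans (ENNReal.ofReal_le_ofReal
          (mul_le_mul_of_nonneg_left hpow (Real.exp_pos _).le))
    _ = ENNReal.ofReal (Real.exp (2 * Real.log L * Real.exp (L / R)) * (r / d) ^ n) := by
        rw [← ENNReal.ofReal_inv_of_pos (by positivity), ← ENNReal.ofReal_mul (by positivity),
          div_pow]
        congr 1
        ring
    _ = _ := by
        rw [hexp, add_sub_cancel_right, sub_eq_add_neg, Real.exp_add, neg_mul, neg_neg,
          mul_comm (Real.log (r / d)), Real.exp_nat_mul, Real.exp_log (div_pos hr0 hd0)]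

/-- Theorem B (case `q = ∞`): for `X̃^{(n)}` uniform on `D̃_{∞,1}^n`, the empirical
average `(1/n) ∑ f(X̃_i^{(n)})` converges in probability to `(1/2) ∫_{-1}^1 f(x) dx`,
i.e. the limiting distribution is uniform on `[-1,1]`. -/
theorem empirical_distribution_lorentzBallInf
    {Ω : Type*} [MeasurableSpace Ω] (P : Measure Ω) [IsProbabilityMeasure P]
    (X : (n : ℕ) → Ω → Fin n → ℝ) (hXmeas : ∀ n, Measurable (X n))
    (hX : ∀ n, Measure.map (X n) P = unifOn (scaledLorentzBallInf n))
    (f : ℝ → ℝ) (hf : Continuous f) (hfb : ∃ C, ∀ x, |f x| ≤ C) :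
    ∀ ε > 0, Tendsto (fun n : ℕ =>
        P {ω | ε < |(1 / (n : ℝ)) * ∑ i : Fin n, f (X n ω i)
                    - (1 / 2) * ∫ x in Set.Icc (-1 : ℝ) 1, f x|})
      atTop (nhds 0) := by
  intro ε hε
  obtain ⟨C, hC⟩ := hfb
  have hset : ∫ x in Set.Icc (-1 : ℝ) 1, f x = ∫ x in (-1 : ℝ)..1, f x := by
    rw [integral_Icc_eq_integral_Ioc, intervalIntegral.integral_of_le (by norm_num)]
  rw [hset]
  set m := (1 / 2) * ∫ x in (-1 : ℝ)..1, f x with hm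
  have hfi : IntervalIntegrable f volume (-1) 1 := hf.intervalIntegrable _ _
  have hupper := tendsto_unifOn_scaledLorentzBallInf_sum_nonneg
    (g := fun t => f t - (m + ε)) (B := C + |m + ε|) (by fun_prop)
    (fun t => (abs_sub _ _).trans (add_le_add_left (hC t) _)) (by
      rw [intervalIntegral.integral_sub hfi (by simp), intervalIntegral.integral_const, smul_eq_mul]
      linarith)
  have hlower := tendsto_unifOn_scaledLorentzBallInf_sum_nonneg
    (g := fun t => (m - ε) - f t) (B := |m - ε| + C) (by fun_prop)
    (fun t => (abs_sub _ _).trans (add_le_add_right (hC t) _)) (by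
      rw [intervalIntegral.integral_sub (by simp) hfi, intervalIntegral.integral_const, smul_eq_mul]
      linarith)
  have hsum := hupper.add hlower
  rw [add_zero] at hsum
  refine tendsto_of_tendsto_of_tendsto_of_le_of_le' tendsto_const_nhds hsum
    (.of_forall fun _ => zero_le) ?_
  filter_upwards [eventually_ge_atTop 1] with n hn
  have hn0 : (0 : ℝ) < n := by exact_mod_cast hn
  rw [← hX n, Measure.map_apply (hXmeas n)
      (isClosed_le continuous_const (by fun_prop)).measurableSet,
    Measure.map_apply (hXmeas n) (isClosed_le continuous_const (by fun_prop)).measurableSet]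
  refine le_trans (measure_mono ?_) (measure_union_le _ _)
  intro ω hω
  have havg : ∑ i, f (X n ω i) = n * ((1 / (n : ℝ)) * ∑ i, f (X n ω i)) := by
    field_simp
  simp only [Set.mem_union, Set.mem_preimage, Set.mem_ofPred_eq, Finset.sum_sub_distrib,
    Finset.sum_const, Finset.card_univ, Fintype.card_fin, nsmul_eq_mul] at hω ⊢
  rw [havg]
  generalize (1 / (n : ℝ)) * ∑ i, f (X n ω i) = a at hω ⊢
  rcases lt_abs.mp hω with h | h
  · exact Or.inl (by linarith [mul_pos hn0 (sub_pos.mpr h)])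
  · exact Or.inr (by linarith [mul_pos hn0 (sub_pos.mpr h)])

end
end

section
/- Let q = ∞ and 1 < r < ∞, and for each n let X^{(n)} be uniformly distributed on D_{∞,1}^n := vol_n(B_{∞,1}^n)^{-1/n} B_{∞,1}^n. Then n^{-1/r} ‖X^{(n)}‖_r converges in probability, as n → ∞, to m_{∞,r} := (1/2)(1/(r+1))^{1/r}. -/
open MeasureTheory Finset Filter
open scoped ENNReal NNReal

noncomputable section

/-- The volume-normalized Lorentz ball `D_{∞,1}^n = vol_n(B_{∞,1}^n)^{-1/n} B_{∞,1}^n`. -/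
def volNormLorentzBallInf (n : ℕ) : Set (Fin n → ℝ) :=
  (fun x => ((volume (lorentzBallInf n)).toReal ^ (-(1 : ℝ) / n)) • x) '' lorentzBallInf n

open scoped Pointwise

lemma sortedAbs_antitone {n : ℕ} (x : Fin n → ℝ) : Antitone (sortedAbs x) := by
  intro i j hij
  exact Tuple.monotone_sort (fun j => |x j|) (Fin.rev_le_rev.mpr hij)

lemma sortedAbs_nonneg {n : ℕ} (x : Fin n → ℝ) (i : Fin n) : 0 ≤ sortedAbs x i :=
  abs_nonneg _

lemma prod_sortedAbs {n : ℕ} (x : Fin n → ℝ) (f : ℝ → ℝ) :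
    ∏ i, f (sortedAbs x i) = ∏ i, f |x i| :=
  Equiv.prod_comp (Fin.revPerm.trans (Tuple.sort fun j => |x j|)) fun i => f |x i|

lemma sum_sortedAbs {n : ℕ} (x : Fin n → ℝ) (f : ℝ → ℝ) :
    ∑ i, f (sortedAbs x i) = ∑ i, f |x i| :=
  Equiv.sum_comp (Fin.revPerm.trans (Tuple.sort fun j => |x j|)) fun i => f |x i|

lemma exists_sortedAbs_eq {n : ℕ} (x : Fin n → ℝ) (i : Fin n) : ∃ j, sortedAbs x j = |x i| :=
  ⟨(Fin.revPerm.trans (Tuple.sort fun j => |x j|)).symm i,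
    congrArg (fun i => |x i|)
      ((Fin.revPerm.trans (Tuple.sort fun j => |x j|)).apply_symm_apply i)⟩

lemma harmonic_cast (n : ℕ) : (harmonic n : ℝ) = ∑ i ∈ range n, ((i : ℝ) + 1)⁻¹ := by
  simp [harmonic]

lemma harmonic_mono_real : Monotone fun n : ℕ => (harmonic n : ℝ) := by
  refine monotone_nat_of_le_succ fun n => ?_
  simp only [harmonic_succ]
  push_cast
  have : (0 : ℝ) ≤ ((n : ℝ) + 1)⁻¹ := by positivity
  linarith

lemma one_le_harmonic {n : ℕ} (hn : 1 ≤ n) : (1 : ℝ) ≤ harmonic n := by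
  simpa [harmonic] using harmonic_mono_real hn

lemma harmonic_mul_sortedAbs_le {n : ℕ} (x : Fin n → ℝ) (j : Fin n) :
    (harmonic (j + 1) : ℝ) * sortedAbs x j ≤ lorentzNormInf x := by
  have h : (harmonic (j + 1) : ℝ) = ∑ i ∈ Finset.Iic j, ((i : ℝ) + 1)⁻¹ := by
    rw [harmonic_cast]
    refine (Finset.sum_bij (fun (i : Fin n) _ => (i : ℕ)) ?_ ?_ ?_ ?_).symm
    · intro i hi
      simpa [Nat.lt_succ_iff] using hi
    · intro i _ i' _ h
      exact Fin.ext h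
    · intro b hb
      have hb' : b < j + 1 := by simpa using hb
      exact ⟨⟨b, by omega⟩, by simp [Fin.le_def]; omega, rfl⟩
    · intros
      rfl
  rw [h, Finset.sum_mul, lorentzNormInf]
  calc ∑ i ∈ Finset.Iic j, ((i : ℝ) + 1)⁻¹ * sortedAbs x j
      ≤ ∑ i ∈ Finset.Iic j, ((i : ℝ) + 1)⁻¹ * sortedAbs x i := by
        refine Finset.sum_le_sum fun i hi => ?_
        gcongr
        exact sortedAbs_antitone x (by simpa using hi)
    _ ≤ _ := Finset.sum_le_sum_of_subset_of_nonneg (Finset.subset_univ _) fun i _ _ =>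
        mul_nonneg (by positivity) (sortedAbs_nonneg x i)

lemma sortedAbs_le_inv_harmonic {n : ℕ} {x : Fin n → ℝ} (hx : x ∈ lorentzBallInf n)
    {k : ℕ} (hk : 1 ≤ k) {j : Fin n} (hj : k ≤ j + 1) :
    sortedAbs x j ≤ (harmonic k : ℝ)⁻¹ := by
  have hk' := one_le_harmonic hk
  have h1 := (harmonic_mul_sortedAbs_le x j).trans hx
  have h2 := mul_le_mul_of_nonneg_right (harmonic_mono_real hj) (sortedAbs_nonneg x j)
  rw [← one_div, le_div_iff₀' (by linarith)]
  exact h2.trans h1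

lemma abs_le_one_of_mem_lorentzBallInf {n : ℕ} {x : Fin n → ℝ} (hx : x ∈ lorentzBallInf n)
    (i : Fin n) : |x i| ≤ 1 := by
  obtain ⟨j, hj⟩ := exists_sortedAbs_eq x i
  simpa [hj, harmonic] using sortedAbs_le_inv_harmonic hx le_rfl (j := j) (by omega)

lemma Icc_subset_lorentzBallInf {n : ℕ} (hn : 1 ≤ n) :
    Set.Icc (fun _ => -(harmonic n : ℝ)⁻¹) (fun _ => (harmonic n : ℝ)⁻¹) ⊆ lorentzBallInf n := by
  intro x hx
  have hpos := one_le_harmonic hn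
  calc lorentzNormInf x ≤ ∑ i : Fin n, ((i : ℝ) + 1)⁻¹ * (harmonic n : ℝ)⁻¹ := by
        refine Finset.sum_le_sum fun i _ => ?_
        gcongr
        exact abs_le.mpr ⟨hx.1 _, hx.2 _⟩
    _ = 1 := by
        rw [← Finset.sum_mul, Fin.sum_univ_eq_sum_range fun i : ℕ => ((i : ℝ) + 1)⁻¹,
          ← harmonic_cast, mul_inv_cancel₀ (by linarith)]

lemma le_volume_lorentzBallInf {n : ℕ} (hn : 1 ≤ n) :
    ENNReal.ofReal ((2 / (harmonic n : ℝ)) ^ n) ≤ volume (lorentzBallInf n) := by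
  have hpos := one_le_harmonic hn
  refine le_trans (le_of_eq ?_) (measure_mono (Icc_subset_lorentzBallInf hn))
  rw [Real.volume_Icc_pi, Finset.prod_const, Finset.card_univ, Fintype.card_fin,
    ENNReal.ofReal_pow (by positivity)]
  congr 2
  ring

lemma volume_le_of_le_prod {n : ℕ} {F : ℝ → ℝ} (hF : Integrable F) (hF0 : ∀ t, 0 ≤ F t)
    (hFm : Measurable F) {S : Set (Fin n → ℝ)} {c : ℝ} (hc : 0 < c)
    (h : ∀ x ∈ S, c ≤ ∏ i, F (x i)) :
    volume S ≤ ENNReal.ofReal ((∫ t, F t) ^ n / c) := by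
  have hm : Measurable fun x : Fin n → ℝ => ENNReal.ofReal (∏ i, F (x i)) := by fun_prop
  have hint : Integrable fun x : Fin n → ℝ => ∏ i, F (x i) :=
    Integrable.fintype_prod fun _ => hF
  have h1 := mul_meas_ge_le_lintegral (μ := volume) hm (ENNReal.ofReal c)
  rw [← ofReal_integral_eq_lintegral_ofReal hint
    (ae_of_all _ fun x => Finset.prod_nonneg fun i _ => hF0 _),
    integral_fintype_prod_volume_eq_pow, Fintype.card_fin] at h1
  rw [ENNReal.ofReal_div_of_pos hc, ENNReal.le_div_iff_mul_le (by simp [hc]) (by simp), mul_comm]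
  refine le_trans ?_ h1
  gcongr
  exact fun x hx => ENNReal.ofReal_le_ofReal (h x hx)

/-- The one-dimensional density `1` on `[-a, a]` plus `M⁻¹` on `[-1, 1]`, tilted by `exp (l g)`. -/
def tiltedWeight (a M l : ℝ) (g : ℝ → ℝ) (t : ℝ) : ℝ :=
  (Set.Icc (-a) a).indicator (fun t => Real.exp (l * g t)) t +
    M⁻¹ * (Set.Icc (-1) 1).indicator (fun t => Real.exp (l * g t)) t

lemma tiltedWeight_nonneg {a M l : ℝ} (hM : 0 ≤ M) (g : ℝ → ℝ) (t : ℝ) :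
    0 ≤ tiltedWeight a M l g t :=
  add_nonneg (Set.indicator_nonneg (fun _ _ => (Real.exp_pos _).le) _)
    (mul_nonneg (by positivity) (Set.indicator_nonneg (fun _ _ => (Real.exp_pos _).le) _))

lemma measurable_tiltedWeight {a M l : ℝ} {g : ℝ → ℝ} (hg : Measurable g) :
    Measurable (tiltedWeight a M l g) := by
  have h : Measurable fun t => Real.exp (l * g t) := by fun_prop
  exact (h.indicator measurableSet_Icc).add ((h.indicator measurableSet_Icc).const_mul _)

lemma integrableOn_of_abs_le_one {g : ℝ → ℝ} (hg : Measurable g) (hg1 : ∀ t, |g t| ≤ 1) (b : ℝ) :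
    IntegrableOn g (Set.Icc (-b) b) :=
  Measure.integrableOn_of_bounded (M := 1) (by simp) hg.aestronglyMeasurable
    (ae_of_all _ hg1)

lemma integrableOn_exp_mul {g : ℝ → ℝ} (hg : Measurable g) (hg1 : ∀ t, |g t| ≤ 1) {l : ℝ}
    (hl0 : 0 ≤ l) (b : ℝ) :
    IntegrableOn (fun t => Real.exp (l * g t)) (Set.Icc (-b) b) := by
  refine Measure.integrableOn_of_bounded (M := Real.exp l) (by simp)
    (by fun_prop) (ae_of_all _ fun t => ?_)
  rw [Real.norm_eq_abs, Real.abs_exp, Real.exp_le_exp]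
  nlinarith [(abs_le.mp (hg1 t)).2]

lemma integrable_tiltedWeight {a M l : ℝ} {g : ℝ → ℝ} (hg : Measurable g)
    (hg1 : ∀ t, |g t| ≤ 1) (hl0 : 0 ≤ l) : Integrable (tiltedWeight a M l g) :=
  ((integrable_indicator_iff measurableSet_Icc).mpr (integrableOn_exp_mul hg hg1 hl0 a)).add
    (((integrable_indicator_iff measurableSet_Icc).mpr
      (integrableOn_exp_mul hg hg1 hl0 1)).const_mul _)

lemma integral_tiltedWeight_le {a M l : ℝ} {g : ℝ → ℝ} (hg : Measurable g)
    (hg1 : ∀ t, |g t| ≤ 1) (hl0 : 0 ≤ l) (hl1 : l ≤ 1) (ha : 0 ≤ a) (hM : 0 < M)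
    (hg0 : ∫ t in Set.Icc (-a) a, g t = 0) :
    ∫ t, tiltedWeight a M l g t ≤ 2 * a * (1 + l ^ 2) + 6 / M := by
  have hA : ∫ t in Set.Icc (-a) a, Real.exp (l * g t) ≤ 2 * a * (1 + l ^ 2) := by
    have hi := integrableOn_of_abs_le_one hg hg1 a
    have hc : IntegrableOn (fun _ : ℝ => 1 + l ^ 2) (Set.Icc (-a) a) := by simp
    calc ∫ t in Set.Icc (-a) a, Real.exp (l * g t)
        ≤ ∫ t in Set.Icc (-a) a, ((1 + l ^ 2) + l * g t) := by
          refine setIntegral_mono (integrableOn_exp_mul hg hg1 hl0 a) (hc.add (hi.const_mul l))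
            fun t => ?_
          have hlg : |l * g t| ≤ l := by
            rw [abs_mul, abs_of_nonneg hl0]
            nlinarith [hg1 t]
          have h := (abs_le.mp (Real.abs_exp_sub_one_sub_id_le (hlg.trans hl1))).2
          have h2 : (l * g t) ^ 2 ≤ l ^ 2 := sq_le_sq' (abs_le.mp hlg).1 (abs_le.mp hlg).2
          simp only
          linarith
      _ = 2 * a * (1 + l ^ 2) := by
          rw [integral_add hc (hi.const_mul l), integral_const_mul, hg0]
          rw [setIntegral_const, Real.volume_real_Icc_of_le (by linarith), smul_eq_mul]
          ring
  have hB : ∫ t in Set.Icc (-1 : ℝ) 1, Real.exp (l * g t) ≤ 6 := by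
    have hc : IntegrableOn (fun _ : ℝ => (3 : ℝ)) (Set.Icc (-1) 1) := by simp
    calc ∫ t in Set.Icc (-1 : ℝ) 1, Real.exp (l * g t) ≤ ∫ t in Set.Icc (-1 : ℝ) 1, (3 : ℝ) := by
          refine setIntegral_mono (integrableOn_exp_mul hg hg1 hl0 1) hc fun t => ?_
          refine le_trans (Real.exp_le_exp.mpr ?_) (Real.exp_one_lt_d9.le.trans (by norm_num))
          nlinarith [(abs_le.mp (hg1 t)).2]
      _ = 6 := by
          rw [setIntegral_const, Real.volume_real_Icc_of_le (by norm_num), smul_eq_mul]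
          norm_num
  unfold tiltedWeight
  rw [integral_add ((integrable_indicator_iff measurableSet_Icc).mpr
      (integrableOn_exp_mul hg hg1 hl0 a)) (((integrable_indicator_iff measurableSet_Icc).mpr
      (integrableOn_exp_mul hg hg1 hl0 1)).const_mul _), integral_const_mul,
    integral_indicator measurableSet_Icc, integral_indicator measurableSet_Icc]
  have : M⁻¹ * ∫ t in Set.Icc (-1 : ℝ) 1, Real.exp (l * g t) ≤ 6 / M := by
    rw [div_eq_inv_mul]
    gcongr
  linarith

lemma le_prod_tiltedWeight {n k : ℕ} (hk : 1 ≤ k) {M l : ℝ} (hM : 1 ≤ M) (g : ℝ → ℝ)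
    {x : Fin n → ℝ} (hx : x ∈ lorentzBallInf n) :
    M⁻¹ ^ k * Real.exp (l * ∑ i, g (x i)) ≤
      ∏ i, tiltedWeight (harmonic k : ℝ)⁻¹ M l g (x i) := by
  set a : ℝ := (harmonic k : ℝ)⁻¹
  have hM0 : 0 < M := by linarith
  have hMinv : M⁻¹ ≤ 1 := inv_le_one_of_one_le₀ hM
  let W : ℝ → ℝ := fun u => if u ≤ a then 1 else M⁻¹
  have hW0 : ∀ u, 0 ≤ W u := fun u => by
    simp only [W]
    split_ifs <;> positivity
  have hW : M⁻¹ ^ k ≤ ∏ i, W |x i| := by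
    rw [← prod_sortedAbs x W]
    calc M⁻¹ ^ k ≤ ∏ j : Fin n, (if (j : ℕ) < k then M⁻¹ else 1) := by
          rw [Finset.prod_ite, Finset.prod_const, Finset.prod_const_one, mul_one]
          refine pow_le_pow_of_le_one (by positivity) hMinv ?_
          calc _ ≤ (range k).card := Finset.card_le_card_of_injOn (fun j : Fin n => (j : ℕ))
                (fun j hj => by simpa using hj) (fun i _ j _ h => Fin.ext h)
            _ = k := by simp
      _ ≤ _ := by
          refine Finset.prod_le_prod (fun j _ => by split_ifs <;> positivity) fun j _ => ?_
          split_ifs with hj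
          · simp only [W]
            split_ifs <;> simp [hMinv]
          · simp only [W]
            rw [if_pos (sortedAbs_le_inv_harmonic hx hk (by omega))]
  calc M⁻¹ ^ k * Real.exp (l * ∑ i, g (x i))
      ≤ (∏ i, W |x i|) * Real.exp (l * ∑ i, g (x i)) := by gcongr
    _ = ∏ i, W |x i| * Real.exp (l * g (x i)) := by
        rw [Finset.mul_sum, Real.exp_sum, Finset.prod_mul_distrib]
    _ ≤ _ := by
        refine Finset.prod_le_prod (fun i _ => mul_nonneg (hW0 _) (Real.exp_pos _).le)
          fun i _ => ?_
        have h1 : x i ∈ Set.Icc (-1 : ℝ) 1 := abs_le.mp (abs_le_one_of_mem_lorentzBallInf hx i)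
        simp only [W, tiltedWeight]
        rw [Set.indicator_of_mem h1]
        have h3 : 0 ≤ M⁻¹ * Real.exp (l * g (x i)) := by positivity
        split_ifs with h
        · rw [Set.indicator_of_mem (show x i ∈ Set.Icc (-a) a from abs_le.mp h)]
          linarith
        · exact le_add_of_nonneg_left (Set.indicator_nonneg (fun _ _ => (Real.exp_pos _).le) _)

lemma volume_lorentzBallInf_inter_le {n k : ℕ} (hn : 1 ≤ n) (hk : 1 ≤ k) {l d : ℝ} {g : ℝ → ℝ}
    (hg : Measurable g) (hg1 : ∀ t, |g t| ≤ 1) (hl0 : 0 ≤ l) (hl1 : l ≤ 1)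
    (hg0 : ∫ t in Set.Icc (-(harmonic k : ℝ)⁻¹) (harmonic k : ℝ)⁻¹, g t = 0) :
    volume {x | x ∈ lorentzBallInf n ∧ d * n ≤ ∑ i, g (x i)} ≤
      ENNReal.ofReal ((2 / (harmonic k : ℝ) * (1 + l ^ 2) + 6 / n) ^ n *
        ((n : ℝ) ^ k * Real.exp (-(l * (d * n))))) := by
  have hn1 : (1 : ℝ) ≤ n := by exact_mod_cast hn
  have hk1 := one_le_harmonic hk
  have h := volume_le_of_le_prod (n := n) (S := {x | x ∈ lorentzBallInf n ∧ d * n ≤ ∑ i, g (x i)})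
    (c := (n : ℝ)⁻¹ ^ k * Real.exp (l * (d * n)))
    (integrable_tiltedWeight (a := (harmonic k : ℝ)⁻¹) (M := n) hg hg1 hl0)
    (tiltedWeight_nonneg (by positivity) g) (measurable_tiltedWeight hg) (by positivity)
    (fun x hx => le_trans (by gcongr; exact hx.2) (le_prod_tiltedWeight hk hn1 g hx.1))
  refine h.trans (ENNReal.ofReal_le_ofReal ?_)
  rw [div_eq_mul_inv, mul_inv, inv_pow, inv_inv, ← Real.exp_neg]
  gcongr
  · exact integral_nonneg (tiltedWeight_nonneg (by positivity) g)
  · simpa only [div_eq_mul_inv] using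
      integral_tiltedWeight_le hg hg1 hl0 hl1 (by positivity) (by positivity) hg0

/-- The number of large coordinates that are discarded. -/
def cutoff (r : ℝ) (n : ℕ) : ℕ := ⌈(n : ℝ) / Real.log n ^ (r + 1)⌉₊

lemma tendsto_log_natCast : Tendsto (fun n : ℕ => Real.log n) atTop atTop :=
  Real.tendsto_log_atTop.comp tendsto_natCast_atTop_atTop

lemma eventually_one_le_cutoff (r : ℝ) : ∀ᶠ n : ℕ in atTop, 1 ≤ cutoff r n := by
  filter_upwards [tendsto_log_natCast.eventually_ge_atTop 1, eventually_ge_atTop 1] with n hL hn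
  have : (0 : ℝ) < n := by exact_mod_cast hn
  exact Nat.one_le_ceil_iff.mpr (by positivity)

lemma tendsto_cutoff_mul_log_rpow_div {r : ℝ} (hr : 1 < r) :
    Tendsto (fun n : ℕ => (cutoff r n : ℝ) * (1 + Real.log n) ^ r / n) atTop (nhds 0) := by
  have h1 : Tendsto (fun n : ℕ => 2 ^ r / Real.log n) atTop (nhds 0) :=
    tendsto_const_nhds.div_atTop tendsto_log_natCast
  have h2 : Tendsto (fun n : ℕ => 2 ^ r * (Real.log n ^ r / (n : ℝ))) atTop (nhds 0) := by
    have h := ((isLittleO_log_rpow_rpow_atTop r one_pos).tendsto_div_nhds_zero).comp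
      (tendsto_natCast_atTop_atTop (R := ℝ))
    simpa using h.const_mul (2 ^ r)
  refine squeeze_zero' (Eventually.of_forall fun n => ?_) ?_ (by simpa using h1.add h2)
  · have := Real.log_natCast_nonneg n
    positivity
  filter_upwards [tendsto_log_natCast.eventually_ge_atTop 1, eventually_ge_atTop 1] with n hL hn
  have hn' : (0 : ℝ) < n := by exact_mod_cast hn
  set L := Real.log n
  have hL0 : 0 < L := by linarith
  have hk : (cutoff r n : ℝ) ≤ n / L ^ (r + 1) + 1 := (Nat.ceil_lt_add_one (by positivity)).le
  have hp : (1 + L) ^ r ≤ 2 ^ r * L ^ r := by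
    rw [← Real.mul_rpow (by norm_num) hL0.le]
    exact Real.rpow_le_rpow (by linarith) (by linarith) (by linarith)
  calc (cutoff r n : ℝ) * (1 + L) ^ r / n
      ≤ (n / L ^ (r + 1) + 1) * (2 ^ r * L ^ r) / n := by gcongr
    _ = 2 ^ r / L + 2 ^ r * (L ^ r / n) := by
        rw [Real.rpow_add hL0, Real.rpow_one]
        field_simp

lemma eventually_cutoff_le {r : ℝ} (hr : 1 < r) : ∀ᶠ n : ℕ in atTop, cutoff r n ≤ n := by
  filter_upwards [(tendsto_cutoff_mul_log_rpow_div hr).eventually_le_const one_pos,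
    eventually_ge_atTop 1] with n h hn
  have hn' : (0 : ℝ) < n := by exact_mod_cast hn
  rw [div_le_one hn'] at h
  have : (1 : ℝ) ≤ (1 + Real.log n) ^ r :=
    Real.one_le_rpow (by linarith [Real.log_natCast_nonneg n]) (by linarith)
  exact_mod_cast (le_mul_of_one_le_right (by positivity) this).trans h

lemma tendsto_cutoff_mul_harmonic_rpow_div {r : ℝ} (hr : 1 < r) :
    Tendsto (fun n : ℕ => (cutoff r n : ℝ) * (harmonic (cutoff r n) : ℝ) ^ r / n)
      atTop (nhds 0) := by
  refine squeeze_zero' (Eventually.of_forall fun n => ?_) ?_ (tendsto_cutoff_mul_log_rpow_div hr)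
  · have : (0 : ℝ) ≤ harmonic (cutoff r n) := by
      simpa using harmonic_mono_real (Nat.zero_le (cutoff r n))
    positivity
  · filter_upwards [eventually_cutoff_le hr] with n h
    have h0 : (0 : ℝ) ≤ harmonic (cutoff r n) := by
      simpa using harmonic_mono_real (Nat.zero_le (cutoff r n))
    gcongr
    exact (harmonic_mono_real h).trans (harmonic_le_one_add_log n)

lemma tendsto_cutoff_mul_log_div {r : ℝ} (hr : 1 < r) :
    Tendsto (fun n : ℕ => (cutoff r n : ℝ) * Real.log n / n) atTop (nhds 0) := by
  refine squeeze_zero (fun n => ?_) (fun n => ?_) (tendsto_cutoff_mul_log_rpow_div hr)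
  · have := Real.log_natCast_nonneg n
    positivity
  · have := Real.log_natCast_nonneg n
    gcongr
    calc Real.log n ≤ (1 + Real.log n) ^ (1 : ℝ) := by simp
      _ ≤ _ := Real.rpow_le_rpow_of_exponent_le (by linarith) hr.le

lemma tendsto_harmonic_cutoff_div {r : ℝ} (hr : 1 < r) :
    Tendsto (fun n : ℕ => (harmonic (cutoff r n) : ℝ) / n) atTop (nhds 0) := by
  refine squeeze_zero' (Eventually.of_forall fun n => ?_) ?_
    (tendsto_cutoff_mul_harmonic_rpow_div hr)
  · have : (0 : ℝ) ≤ harmonic (cutoff r n) := by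
      simpa using harmonic_mono_real (Nat.zero_le (cutoff r n))
    positivity
  · filter_upwards [eventually_one_le_cutoff r] with n h
    have h0 := one_le_harmonic h
    gcongr
    calc (harmonic (cutoff r n) : ℝ) ≤ (harmonic (cutoff r n) : ℝ) ^ r :=
          Real.self_le_rpow_of_one_le h0 hr.le
      _ ≤ _ := le_mul_of_one_le_left (by positivity) (by exact_mod_cast h)

lemma tendsto_harmonic_div_harmonic_cutoff {r : ℝ} (hr : 1 < r) :
    Tendsto (fun n : ℕ => (harmonic n : ℝ) / harmonic (cutoff r n)) atTop (nhds 1) := by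
  have hinv : Tendsto (fun n : ℕ => (Real.log n)⁻¹) atTop (nhds 0) :=
    tendsto_log_natCast.inv_tendsto_atTop
  have hll : Tendsto (fun n : ℕ => Real.log (Real.log n) / Real.log n) atTop (nhds 0) :=
    (Real.isLittleO_log_id_atTop.tendsto_div_nhds_zero).comp tendsto_log_natCast
  have hden : Tendsto (fun n : ℕ => 1 - (r + 1) * (Real.log (Real.log n) / Real.log n))
      atTop (nhds 1) := by
    simpa using (hll.const_mul (r + 1)).const_sub 1
  have hup : Tendsto (fun n : ℕ => ((Real.log n)⁻¹ + 1) /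
      (1 - (r + 1) * (Real.log (Real.log n) / Real.log n))) atTop (nhds 1) := by
    simpa [Pi.div_def] using (hinv.add_const 1).div hden one_ne_zero
  refine tendsto_of_tendsto_of_tendsto_of_le_of_le' tendsto_const_nhds hup ?_ ?_
  · filter_upwards [eventually_one_le_cutoff r, eventually_cutoff_le hr] with n h1 h2
    rw [one_le_div (by linarith [one_le_harmonic h1])]
    exact harmonic_mono_real h2
  · filter_upwards [eventually_one_le_cutoff r, eventually_ge_atTop 1,
      tendsto_log_natCast.eventually_ge_atTop 1, hden.eventually_const_lt one_pos]
      with n h1 hn hL hd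
    have hn' : (0 : ℝ) < n := by exact_mod_cast hn
    set L := Real.log n
    have hL0 : 0 < L := by linarith
    have hlow : L - (r + 1) * Real.log L ≤ harmonic (cutoff r n) := by
      calc L - (r + 1) * Real.log L = Real.log (n / L ^ (r + 1)) := by
            rw [Real.log_div (by positivity) (by positivity), Real.log_rpow hL0]
        _ ≤ Real.log ↑(cutoff r n + 1) := by
            refine Real.log_le_log (by positivity) ?_
            push_cast
            exact (Nat.le_ceil _).trans (by simp [cutoff, L])
        _ ≤ _ := log_add_one_le_harmonic _
    have hq := one_le_harmonic h1
    have heq : L - (r + 1) * Real.log L = L * (1 - (r + 1) * (Real.log L / L)) := by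
      field_simp
    rw [div_le_div_iff₀ (by linarith) hd]
    calc (harmonic n : ℝ) * (1 - (r + 1) * (Real.log L / L))
        ≤ (1 + L) * (1 - (r + 1) * (Real.log L / L)) := by
          gcongr
          exact harmonic_le_one_add_log n
      _ = (L⁻¹ + 1) * (L * (1 - (r + 1) * (Real.log L / L))) := by
          field_simp
      _ ≤ _ := by
          rw [← heq]
          gcongr

/-- The `n`-th root of the tail bound for the Lorentz ball relative to the cube inside it. -/
def tailBase (r l d : ℝ) (n : ℕ) : ℝ :=
  (harmonic n : ℝ) / harmonic (cutoff r n) *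
    (1 + l ^ 2 + 3 * ((harmonic (cutoff r n) : ℝ) / n)) *
    Real.exp ((cutoff r n : ℝ) * Real.log n / n) * Real.exp (-(l * d))

lemma tendsto_tailBase {r : ℝ} (hr : 1 < r) (l d : ℝ) :
    Tendsto (tailBase r l d) atTop (nhds ((1 + l ^ 2) * Real.exp (-(l * d)))) := by
  have h1 := (tendsto_harmonic_cutoff_div hr).const_mul 3
  have h2 := (Real.continuous_exp.tendsto 0).comp (tendsto_cutoff_mul_log_div hr)
  unfold tailBase
  simpa using (((tendsto_harmonic_div_harmonic_cutoff hr).mul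
    (h1.const_add (1 + l ^ 2))).mul h2).mul_const (Real.exp (-(l * d)))

lemma tailBase_nonneg (r l d : ℝ) (n : ℕ) : 0 ≤ tailBase r l d n := by
  have h (m : ℕ) : (0 : ℝ) ≤ harmonic m := by
    simpa using harmonic_mono_real (Nat.zero_le m)
  have := h n
  have := h (cutoff r n)
  unfold tailBase
  positivity

lemma volume_lorentzBallInf_inter_le_tailBase {r : ℝ} {n : ℕ} (hn : 1 ≤ n)
    (hk : 1 ≤ cutoff r n) {l d : ℝ} {g : ℝ → ℝ}
    (hg : Measurable g) (hg1 : ∀ t, |g t| ≤ 1) (hl0 : 0 ≤ l) (hl1 : l ≤ 1)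
    (hg0 : ∫ t in Set.Icc (-(harmonic (cutoff r n) : ℝ)⁻¹) (harmonic (cutoff r n) : ℝ)⁻¹,
      g t = 0) :
    volume {x | x ∈ lorentzBallInf n ∧ d * n ≤ ∑ i, g (x i)} ≤
      ENNReal.ofReal ((2 / (harmonic n : ℝ)) ^ n * tailBase r l d n ^ n) := by
  refine (volume_lorentzBallInf_inter_le hn hk hg hg1 hl0 hl1 hg0).trans
    (ENNReal.ofReal_le_ofReal (le_of_eq ?_))
  have hh := one_le_harmonic hn
  have hq := one_le_harmonic hk
  have hn' : (0 : ℝ) < n := by exact_mod_cast hn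
  have e1 : (n : ℝ) ^ cutoff r n = Real.exp ((cutoff r n : ℝ) * Real.log n / n) ^ n := by
    rw [← Real.exp_nat_mul, mul_div_cancel₀ _ hn'.ne', Real.exp_nat_mul, Real.exp_log hn']
  have e2 : Real.exp (-(l * (d * n))) = Real.exp (-(l * d)) ^ n := by
    rw [← Real.exp_nat_mul]
    ring_nf
  rw [e1, e2, ← mul_pow, ← mul_pow, ← mul_pow, tailBase]
  congr 1
  field_simp
  ring

/-- The centred truncated power `min (q |t|) 1 ^ r - 1 / (r + 1)`. -/
def truncPow (r q t : ℝ) : ℝ := min (q * |t|) 1 ^ r - 1 / (r + 1)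

lemma measurable_truncPow (r q : ℝ) : Measurable (truncPow r q) := by
  unfold truncPow
  fun_prop

lemma abs_truncPow_le_one {r q : ℝ} (hr : 1 < r) (hq : 0 ≤ q) (t : ℝ) :
    |truncPow r q t| ≤ 1 := by
  have h0 : 0 ≤ min (q * |t|) 1 := le_min (by positivity) zero_le_one
  have h1 := Real.rpow_nonneg h0 r
  have h2 := Real.rpow_le_one h0 (min_le_right _ _) (by linarith : 0 ≤ r)
  have h3 : 1 / (r + 1) ≤ 1 := by
    rw [div_le_one (by linarith)]
    linarith
  have h4 : 0 ≤ 1 / (r + 1) := by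
    have : 0 < r + 1 := by linarith
    positivity
  rw [truncPow, abs_le]
  constructor <;> linarith

lemma integral_truncPow {r q : ℝ} (hr : 1 < r) (hq : 0 < q) :
    ∫ t in Set.Icc (-q⁻¹) q⁻¹, truncPow r q t = 0 := by
  have hq' : 0 < q⁻¹ := inv_pos.mpr hq
  have hint (u v : ℝ) : IntervalIntegrable (truncPow r q) volume u v :=
    Continuous.intervalIntegrable (by
      unfold truncPow
      exact ((by fun_prop : Continuous fun t : ℝ => min (q * |t|) 1).rpow_const
        fun _ => Or.inr (by linarith)).sub continuous_const) u v
  have hpos : ∫ t in (0 : ℝ)..q⁻¹, truncPow r q t = 0 := by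
    have h1 : ∫ t in (0 : ℝ)..q⁻¹, truncPow r q t =
        ∫ t in (0 : ℝ)..q⁻¹, (fun u => u ^ r - 1 / (r + 1)) (q * t) := by
      refine intervalIntegral.integral_congr fun t ht => ?_
      rw [Set.uIcc_of_le hq'.le] at ht
      have : q * t ≤ 1 := by
        calc q * t ≤ q * q⁻¹ := by gcongr; exact ht.2
          _ = 1 := mul_inv_cancel₀ hq.ne'
      simp only [truncPow, abs_of_nonneg ht.1, min_eq_left this]
    rw [h1, intervalIntegral.integral_comp_mul_left (fun u => u ^ r - 1 / (r + 1)) hq.ne',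
      mul_zero, mul_inv_cancel₀ hq.ne', intervalIntegral.integral_sub (intervalIntegral.intervalIntegrable_rpow' (by linarith))
        (by simp), integral_rpow (Or.inl (by linarith))]
    simp [Real.zero_rpow (by linarith : r + 1 ≠ 0)]
  have hneg : ∫ t in (-q⁻¹)..0, truncPow r q t = 0 := by
    have h := intervalIntegral.integral_comp_neg (a := 0) (b := q⁻¹) (truncPow r q)
    rw [neg_zero] at h
    rw [← h]
    simpa [truncPow] using hpos
  rw [integral_Icc_eq_integral_Ioc, ← intervalIntegral.integral_of_le (by linarith),
    ← intervalIntegral.integral_add_adjacent_intervals (hint _ 0) (hint 0 _), hpos, hneg, add_zero]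

lemma abs_sum_rpow_sub_sum_truncPow_le {r : ℝ} (hr : 1 < r) {n k : ℕ} (hk : 1 ≤ k)
    {x : Fin n → ℝ} (hx : x ∈ lorentzBallInf n) :
    |∑ i, ((harmonic k : ℝ) * |x i|) ^ r - n * (1 / (r + 1)) -
      ∑ i, truncPow r (harmonic k : ℝ) (x i)| ≤ k * (harmonic k : ℝ) ^ r := by
  set q : ℝ := (harmonic k : ℝ)
  have hq : 1 ≤ q := one_le_harmonic hk
  let f : ℝ → ℝ := fun u => (q * u) ^ r - min (q * u) 1 ^ r
  have h1 : ∑ i, (q * |x i|) ^ r - n * (1 / (r + 1)) - ∑ i, truncPow r q (x i) =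
      ∑ i, f |x i| := by
    simp only [truncPow, f, Finset.sum_sub_distrib, Finset.sum_const, Finset.card_univ,
      Fintype.card_fin, nsmul_eq_mul]
    ring
  have hf0 (j : Fin n) : 0 ≤ f (sortedAbs x j) := by
    have := sortedAbs_nonneg x j
    exact sub_nonneg.mpr (Real.rpow_le_rpow (le_min (by positivity) zero_le_one)
      (min_le_left _ _) (by linarith))
  have hf1 (j : Fin n) : f (sortedAbs x j) ≤ if (j : ℕ) < k then q ^ r else 0 := by
    have h0 := sortedAbs_nonneg x j
    split_ifs with hj
    · have hle : sortedAbs x j ≤ 1 := by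
        simpa [harmonic] using sortedAbs_le_inv_harmonic hx le_rfl (j := j) (by omega)
      have h2 : (q * sortedAbs x j) ^ r ≤ q ^ r :=
        Real.rpow_le_rpow (by positivity) (mul_le_of_le_one_right (by linarith) hle) (by linarith)
      have h3 : 0 ≤ min (q * sortedAbs x j) 1 ^ r :=
        Real.rpow_nonneg (le_min (by positivity) zero_le_one) r
      simp only [f]
      linarith
    · have h2 : q * sortedAbs x j ≤ 1 := by
        calc q * sortedAbs x j ≤ q * q⁻¹ := by
              gcongr
              exact sortedAbs_le_inv_harmonic hx hk (by omega)
          _ = 1 := mul_inv_cancel₀ (by linarith)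
      simp [f, min_eq_left h2]
  rw [h1, ← sum_sortedAbs x f, abs_of_nonneg (Finset.sum_nonneg fun j _ => hf0 j)]
  calc ∑ j, f (sortedAbs x j) ≤ ∑ j : Fin n, if (j : ℕ) < k then q ^ r else 0 :=
        Finset.sum_le_sum fun j _ => hf1 j
    _ = ((Finset.univ.filter fun j : Fin n => (j : ℕ) < k).card : ℝ) * q ^ r := by
        rw [← Finset.sum_filter, Finset.sum_const, nsmul_eq_mul]
    _ ≤ _ := by
        gcongr
        calc _ ≤ (range k).card := Finset.card_le_card_of_injOn (fun j : Fin n => (j : ℕ))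
              (fun j hj => by simpa using hj) (fun i _ j _ h => Fin.ext h)
          _ = k := by simp

/-- The points of the Lorentz ball whose centred truncated `r`-th moment exceeds `d`. -/
def deviationSet (r d : ℝ) (n : ℕ) : Set (Fin n → ℝ) :=
  {x | x ∈ lorentzBallInf n ∧ d * n ≤ ∑ i, truncPow r (harmonic (cutoff r n)) (x i)} ∪
    {x | x ∈ lorentzBallInf n ∧ d * n ≤ ∑ i, -truncPow r (harmonic (cutoff r n)) (x i)}

lemma volume_lorentzBallInf_le {r : ℝ} {n : ℕ} (hn : 1 ≤ n) (hk : 1 ≤ cutoff r n) :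
    volume (lorentzBallInf n) ≤
      ENNReal.ofReal ((2 / (harmonic n : ℝ)) ^ n * tailBase r 0 0 n ^ n) := by
  simpa using volume_lorentzBallInf_inter_le_tailBase hn hk (l := 0) (d := 0) (g := fun _ => 0)
    measurable_const (by simp) le_rfl zero_le_one (by simp)

lemma volume_deviationSet_le {r : ℝ} (hr : 1 < r) {n : ℕ} (hn : 1 ≤ n) (hk : 1 ≤ cutoff r n)
    {l d : ℝ} (hl0 : 0 ≤ l) (hl1 : l ≤ 1) :
    volume (deviationSet r d n) ≤
      2 * ENNReal.ofReal ((2 / (harmonic n : ℝ)) ^ n * tailBase r l d n ^ n) := by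
  have hq := one_le_harmonic hk
  rw [two_mul]
  refine (measure_union_le _ _).trans (add_le_add ?_ ?_)
  · exact volume_lorentzBallInf_inter_le_tailBase hn hk (measurable_truncPow _ _)
      (abs_truncPow_le_one hr (by linarith)) hl0 hl1 (integral_truncPow hr (by linarith))
  · exact volume_lorentzBallInf_inter_le_tailBase hn hk (measurable_truncPow _ _).neg
      (fun t => by
        rw [Pi.neg_apply, abs_neg]
        exact abs_truncPow_le_one hr (by linarith) t) hl0 hl1
      (by simp [integral_neg, integral_truncPow hr (show (0 : ℝ) < harmonic (cutoff r n) by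
        linarith)])

lemma tendsto_pow_self_of_tendsto_lt_one {b : ℕ → ℝ} {c : ℝ} (hb0 : ∀ n, 0 ≤ b n)
    (hb : Tendsto b atTop (nhds c)) (hc : c < 1) :
    Tendsto (fun n => b n ^ n) atTop (nhds 0) := by
  obtain ⟨e, hce, he⟩ := exists_between hc
  have he0 : 0 ≤ e := (ge_of_tendsto' hb hb0).trans hce.le
  refine squeeze_zero' (Eventually.of_forall fun n => pow_nonneg (hb0 n) n) ?_
    (tendsto_pow_atTop_nhds_zero_of_lt_one he0 he)
  filter_upwards [hb.eventually_le_const hce] with n hn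
  exact pow_le_pow_left₀ (hb0 n) hn n

lemma tendsto_volume_deviationSet_div {r : ℝ} (hr : 1 < r) {d : ℝ} (hd0 : 0 < d) (hd1 : d ≤ 1) :
    Tendsto (fun n => volume (deviationSet r d n) / volume (lorentzBallInf n))
      atTop (nhds 0) := by
  have hlim : (1 + (d / 2) ^ 2) * Real.exp (-(d / 2 * d)) < 1 := by
    calc (1 + (d / 2) ^ 2) * Real.exp (-(d / 2 * d))
        ≤ Real.exp ((d / 2) ^ 2) * Real.exp (-(d / 2 * d)) := by
          gcongr
          linarith [Real.add_one_le_exp ((d / 2) ^ 2)]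
      _ = Real.exp (-(d / 2) ^ 2) := by
          rw [← Real.exp_add]
          ring_nf
      _ < 1 := by
          rw [Real.exp_lt_one_iff]
          have : 0 < (d / 2) ^ 2 := by positivity
          linarith
  have h0 := tendsto_pow_self_of_tendsto_lt_one (tailBase_nonneg r (d / 2) d)
    (tendsto_tailBase hr (d / 2) d) hlim
  have h1 : Tendsto (fun n => 2 * ENNReal.ofReal (tailBase r (d / 2) d n ^ n))
      atTop (nhds 0) := by
    simpa using ENNReal.Tendsto.const_mul (ENNReal.tendsto_ofReal h0) (Or.inr (by simp))
  refine tendsto_of_tendsto_of_tendsto_of_le_of_le' tendsto_const_nhds h1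
    (Eventually.of_forall fun _ => zero_le) ?_
  filter_upwards [eventually_ge_atTop 1, eventually_one_le_cutoff r] with n hn hk
  have hh := one_le_harmonic hn
  have hc : 0 < (2 / (harmonic n : ℝ)) ^ n := by positivity
  refine ENNReal.div_le_of_le_mul ?_
  calc volume (deviationSet r d n)
      ≤ 2 * ENNReal.ofReal ((2 / (harmonic n : ℝ)) ^ n * tailBase r (d / 2) d n ^ n) :=
        volume_deviationSet_le hr hn hk (by positivity) (by linarith)
    _ = 2 * ENNReal.ofReal (tailBase r (d / 2) d n ^ n) *
          ENNReal.ofReal ((2 / (harmonic n : ℝ)) ^ n) := by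
        rw [ENNReal.ofReal_mul hc.le]
        ring
    _ ≤ _ := by
        gcongr
        exact le_volume_lorentzBallInf hn

/-- The factor by which the Lorentz ball is scaled to have volume one. -/
def normFactor (n : ℕ) : ℝ := (volume (lorentzBallInf n)).toReal ^ (-(1 : ℝ) / n)

lemma tendsto_normFactor_div {r : ℝ} (hr : 1 < r) :
    Tendsto (fun n => normFactor n / (harmonic (cutoff r n) : ℝ)) atTop (nhds (1 / 2)) := by
  have hratio := (tendsto_harmonic_div_harmonic_cutoff hr).const_mul (1 / 2)
  have hbase : Tendsto (tailBase r 0 0) atTop (nhds 1) := by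
    simpa using tendsto_tailBase hr 0 0
  have hlow := hratio.mul (hbase.inv₀ one_ne_zero)
  refine tendsto_of_tendsto_of_tendsto_of_le_of_le' (by simpa using hlow) (by simpa using hratio)
    ?_ ?_ <;>
  filter_upwards [eventually_ge_atTop 1, eventually_one_le_cutoff r,
    hbase.eventually_const_lt one_pos] with n hn hk hb
  all_goals
    have hh := one_le_harmonic hn
    have hq := one_le_harmonic hk
    have hn0 : n ≠ 0 := by omega
    have hroot (u : ℝ) (hu : 0 < u) : (u ^ n) ^ (-(1 : ℝ) / n) = u⁻¹ := by
      rw [neg_div, Real.rpow_neg (by positivity), one_div, Real.pow_rpow_inv_natCast hu.le hn0]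
    have hVle := volume_lorentzBallInf_le hn hk
    have hVtop := ne_top_of_le_ne_top ENNReal.ofReal_ne_top hVle
    have hV1 : (2 / (harmonic n : ℝ)) ^ n ≤ (volume (lorentzBallInf n)).toReal :=
      (ENNReal.ofReal_le_iff_le_toReal hVtop).mp (le_volume_lorentzBallInf hn)
    have hcube : 0 < 2 / (harmonic n : ℝ) := by positivity
    have hexp : -(1 : ℝ) / n ≤ 0 := by
      rw [neg_div]
      exact neg_nonpos.mpr (by positivity)
  · have hV2 : (volume (lorentzBallInf n)).toReal ≤
        (2 / (harmonic n : ℝ) * tailBase r 0 0 n) ^ n := by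
      rw [mul_pow]
      exact ENNReal.toReal_le_of_le_ofReal (by positivity) hVle
    have h := Real.rpow_le_rpow_of_nonpos (lt_of_lt_of_le (by positivity) hV1) hV2 hexp
    rw [hroot _ (by positivity)] at h
    calc _ = (2 / (harmonic n : ℝ) * tailBase r 0 0 n)⁻¹ / (harmonic (cutoff r n) : ℝ) := by
          field_simp
      _ ≤ _ := by
          gcongr
          exact h
  · have h := Real.rpow_le_rpow_of_nonpos (by positivity) hV1 hexp
    rw [hroot _ hcube] at h
    calc _ ≤ (2 / (harmonic n : ℝ))⁻¹ / (harmonic (cutoff r n) : ℝ) := by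
          gcongr
          exact h
      _ = _ := by
          field_simp

lemma rpow_mul_rpow_sum_smul {r : ℝ} (hr : 1 < r) {n : ℕ} {s q : ℝ} (hs : 0 ≤ s)
    (hq : 0 < q) (y : Fin n → ℝ) :
    (n : ℝ) ^ (-(1 : ℝ) / r) * (∑ i, |(s • y) i| ^ r) ^ (1 / r) =
      s / q * ((∑ i, (q * |y i|) ^ r) / n) ^ (1 / r) := by
  have hr0 : r ≠ 0 := by linarith
  have hsum : ∑ i, |(s • y) i| ^ r = (s / q) ^ r * ∑ i, (q * |y i|) ^ r := by
    rw [Finset.mul_sum]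
    refine Finset.sum_congr rfl fun i _ => ?_
    rw [← Real.mul_rpow (by positivity) (by positivity), Pi.smul_apply, smul_eq_mul, abs_mul,
      abs_of_nonneg hs]
    congr 1
    field_simp
  have hnn : 0 ≤ ∑ i, (q * |y i|) ^ r := Finset.sum_nonneg fun i _ => by positivity
  rw [hsum, Real.mul_rpow (by positivity) hnn, ← Real.rpow_mul (by positivity),
    mul_one_div_cancel hr0, Real.rpow_one, Real.div_rpow hnn (by positivity), neg_div,
    Real.rpow_neg (by positivity)]
  ring

/-- Theorem D (`q = ∞`, `1 < r < ∞`): for `X^{(n)}` uniform on the volume-normalized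
Lorentz ball `D_{∞,1}^n`, the quantity `n^{-1/r} ‖X^{(n)}‖_r` converges in
probability to `m_{∞,r} = (1/2)(1/(r+1))^{1/r}`. -/
theorem lln_ellr_norm_inf (r : ℝ) (hr : 1 < r)
    {Ω : Type*} [MeasurableSpace Ω] (P : Measure Ω) [IsProbabilityMeasure P]
    (X : (n : ℕ) → Ω → Fin n → ℝ) (hXmeas : ∀ n, Measurable (X n))
    (hX : ∀ n, Measure.map (X n) P = unifOn (volNormLorentzBallInf n)) :
    ∀ ε > 0, Tendsto (fun n : ℕ =>
        P {ω | ε < |(n : ℝ) ^ (-(1 : ℝ) / r) * (∑ i : Fin n, |X n ω i| ^ r) ^ (1 / r)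
                    - 1 / 2 * (1 / (r + 1)) ^ (1 / r)|})
      atTop (nhds 0) := by
  intro ε hε
  have hcont : ContinuousAt (fun p : ℝ × ℝ => p.1 * p.2 ^ (1 / r)) (1 / 2, 1 / (r + 1)) :=
    continuousAt_fst.mul (continuousAt_snd.rpow_const (Or.inr (by positivity)))
  obtain ⟨δ, hδ, hclose⟩ := Metric.continuousAt_iff.mp hcont ε hε
  set d : ℝ := min (δ / 2) 1
  have hd0 : 0 < d := lt_min (by positivity) one_pos
  have hdδ : d ≤ δ / 2 := min_le_left _ _
  refine tendsto_of_tendsto_of_tendsto_of_le_of_le' tendsto_const_nhds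
    (tendsto_volume_deviationSet_div hr hd0 (min_le_right _ _))
    (Eventually.of_forall fun _ => zero_le) ?_
  filter_upwards [eventually_ge_atTop 1, eventually_one_le_cutoff r,
    (tendsto_normFactor_div hr).eventually (Metric.ball_mem_nhds _ hδ),
    (tendsto_cutoff_mul_harmonic_rpow_div hr).eventually_lt_const (half_pos hδ)]
    with n hn hk hs he
  have hh := one_le_harmonic hn
  have hq := one_le_harmonic hk
  have hn' : (0 : ℝ) < n := by exact_mod_cast hn
  have hVtop := ne_top_of_le_ne_top ENNReal.ofReal_ne_top (volume_lorentzBallInf_le hn hk)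
  have hVpos : 0 < volume (lorentzBallInf n) :=
    lt_of_lt_of_le (ENNReal.ofReal_pos.mpr (by positivity)) (le_volume_lorentzBallInf hn)
  have hs0 : 0 < normFactor n := Real.rpow_pos_of_pos (ENNReal.toReal_pos hVpos.ne' hVtop) _
  set bad : Set (Fin n → ℝ) := {x | ε < |(n : ℝ) ^ (-(1 : ℝ) / r) *
    (∑ i : Fin n, |x i| ^ r) ^ (1 / r) - 1 / 2 * (1 / (r + 1)) ^ (1 / r)|}
  have hbad : MeasurableSet bad := measurableSet_lt measurable_const (by fun_prop)
  have hball : volNormLorentzBallInf n = normFactor n • lorentzBallInf n := rfl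
  have hsub : bad ∩ volNormLorentzBallInf n ⊆ normFactor n • deviationSet r d n := by
    rintro _ ⟨hx, y, hy, rfl⟩
    refine ⟨y, ?_, rfl⟩
    change ε < |(n : ℝ) ^ (-(1 : ℝ) / r) * (∑ i, |(normFactor n • y) i| ^ r) ^ (1 / r) - _| at hx
    rw [rpow_mul_rpow_sum_smul hr hs0.le (show (0 : ℝ) < harmonic (cutoff r n) by linarith)] at hx
    set Z := ∑ i, ((harmonic (cutoff r n) : ℝ) * |y i|) ^ r
    have hfar : δ ≤ |Z / n - 1 / (r + 1)| := by
      by_contra! hlt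
      refine absurd hx (not_lt.mpr (hclose (x := (_, Z / n)) ?_).le)
      rw [Prod.dist_eq]
      exact max_lt hs hlt
    have happrox := abs_sum_rpow_sub_sum_truncPow_le hr hk hy
    rw [div_lt_iff₀ hn'] at he
    have hmul : Z - n * (1 / (r + 1)) = (Z / n - 1 / (r + 1)) * n := by
      field_simp
    have hfar' : δ * n ≤ |Z - n * (1 / (r + 1))| := by
      rw [hmul, abs_mul, abs_of_pos hn']
      gcongr
    have hdn : d * n ≤ δ / 2 * n := by gcongr
    rw [abs_le] at happrox
    rcases le_abs.mp hfar' with h | h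
    · exact Or.inl ⟨hy, by linarith [happrox.2]⟩
    · refine Or.inr ⟨hy, ?_⟩
      rw [Finset.sum_neg_distrib]
      linarith [happrox.1]
  have hP : P {ω | X n ω ∈ bad} = unifOn (volNormLorentzBallInf n) bad := by
    rw [← hX n, Measure.map_apply (hXmeas n) hbad]
    rfl
  calc P {ω | X n ω ∈ bad}
      = (volume (volNormLorentzBallInf n))⁻¹ * volume (bad ∩ volNormLorentzBallInf n) := by
        rw [hP, unifOn, Measure.smul_apply, smul_eq_mul, Measure.restrict_apply hbad]
    _ ≤ (volume (normFactor n • lorentzBallInf n))⁻¹ *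
          volume (normFactor n • deviationSet r d n) := by
        rw [hball] at hsub ⊢
        gcongr
    _ = volume (deviationSet r d n) / volume (lorentzBallInf n) := by
        rw [Measure.addHaar_smul_of_nonneg _ hs0.le, Measure.addHaar_smul_of_nonneg _ hs0.le,
          mul_comm, ← div_eq_mul_inv, ENNReal.mul_div_mul_left]
        · exact (ENNReal.ofReal_pos.mpr (by positivity)).ne'
        · exact ENNReal.ofReal_ne_top

end
end
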